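/- arXiv:1201.4960 — 6 statements merged into one kernel-verified Lean document; each statement's English description precedes it below -/
import Mathlib

section
/- For all integers m ≥ 1 and ℓ ≥ 2, setting n = 2^m and t = 2^ℓ − 1, there exists a set T of permutations of {1,…,n} that is min(t,n)-wise uniform and satisfies |T| ≤ t^(2n). -/
/-- A nonempty set `T` of permutations of `Fin n` (modelling `{1,…,n}`) is `t`-wise uniform if
for every injective tuple `i` and injective tuple `j` of `t` elements,
`|{σ ∈ T : σ(i_m) = j_m ∀ m}| · n·(n−1)⋯(n−t+1) = |T|`. -/
def IsTwiseUniform (n t : ℕ) (T : Finset (Equiv.Perm (Fin n))) : Prop :=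
  T.Nonempty ∧ ∀ i j : Fin t → Fin n, Function.Injective i → Function.Injective j →
    (T.filter (fun σ => ∀ m, σ (i m) = j m)).card * Nat.descFactorial n t = T.card

open Finset Equiv
open scoped Classical in
noncomputable def ind (p : Prop) : ℕ := if p then 1 else 0

lemma ind_congr {p q : Prop} (h : p ↔ q) : ind p = ind q := by
  rw [propext h]

def Sat {α : Type} (σ : Perm α) (C : Finset (α × α)) : Prop := ∀ p ∈ C, σ p.1 = p.2

/-- Strong uniformity: at most `t` constraints (possibly inconsistent) have the right density. -/
def SU {α : Type} [Fintype α] [DecidableEq α] (t : ℕ) (T : Finset (Perm α)) : Prop :=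
  ∀ C : Finset (α × α), #C ≤ t →
    (∑ σ ∈ T, ind (Sat σ C)) * (Fintype.card α).factorial = #T * ∑ σ : Perm α, ind (Sat σ C)

section
variable {α : Type} [Fintype α] [DecidableEq α]

lemma pair_left {t : ℕ} {A : Finset (Perm α)} (hA : SU (2 * t + 1) A)
    (C D : Finset (α × α)) (h : #C + #D ≤ 2 * t + 1) (τ : Perm α) :
    (∑ σ ∈ A, ind (Sat σ C ∧ Sat (σ * τ) D)) * (Fintype.card α).factorial
      = #A * ∑ σ : Perm α, ind (Sat σ C ∧ Sat (σ * τ) D) := by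
  have key : ∀ σ : Perm α, (Sat σ C ∧ Sat (σ * τ) D) ↔
      Sat σ (C ∪ D.image (fun p => (τ p.1, p.2))) := by
    intro σ
    simp only [Sat, mem_union, mem_image, or_imp, forall_and, Perm.mul_apply]
    refine and_congr Iff.rfl ⟨?_, ?_⟩
    · rintro h _ ⟨q, hq, rfl⟩
      exact h q hq
    · intro h p hp
      exact h _ ⟨p, hp, rfl⟩
  simp only [ind_congr (key _)]
  apply hA
  exact (card_union_le _ _).trans ((Nat.add_le_add_left card_image_le _).trans h)

lemma pair_right {t : ℕ} {B : Finset (Perm α)} (hB : SU t B)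
    (C D : Finset (α × α)) (h : #C + #D ≤ 2 * t + 1) :
    (∑ σ : Perm α, ∑ τ ∈ B, ind (Sat σ C ∧ Sat (σ * τ) D)) * (Fintype.card α).factorial
      = #B * ∑ σ : Perm α, ∑ τ : Perm α, ind (Sat σ C ∧ Sat (σ * τ) D) := by
  by_cases hD : #D ≤ t
  · rw [sum_mul, mul_sum]
    refine sum_congr rfl fun σ _ => ?_
    by_cases hC : Sat σ C
    · have key : ∀ τ : Perm α, (Sat σ C ∧ Sat (σ * τ) D) ↔
          Sat τ (D.image (fun p => (p.1, σ⁻¹ p.2))) := by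
        intro τ
        rw [and_iff_right hC]
        simp only [Sat, mem_image, Perm.mul_apply]
        constructor
        · rintro h _ ⟨q, hq, rfl⟩
          simp [← h q hq]
        · intro h p hp
          rw [h _ ⟨p, hp, rfl⟩]; simp
      simp only [ind_congr (key _)]
      exact hB _ (card_image_le.trans hD)
    · simp [hC, ind]
  · have hC : #C ≤ t := by omega
    have e : ∀ τ : Perm α, ∑ σ : Perm α, ind (Sat σ C ∧ Sat (σ * τ) D)
        = ∑ σ : Perm α, ind (Sat (σ * τ⁻¹) C ∧ Sat σ D) := by
      intro τ
      rw [← Equiv.sum_comp (Equiv.mulRight τ) (fun σ => ind (Sat (σ * τ⁻¹) C ∧ Sat σ D))]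
      simp
    have e2 : ∀ S : Finset (Perm α), ∑ σ : Perm α, ∑ τ ∈ S, ind (Sat σ C ∧ Sat (σ * τ) D)
        = ∑ σ : Perm α, ∑ τ ∈ S, ind (Sat (σ * τ⁻¹) C ∧ Sat σ D) := by
      intro S
      rw [sum_comm, sum_congr rfl fun τ _ => e τ, sum_comm]
    rw [e2, e2, sum_mul, mul_sum]
    refine sum_congr rfl fun σ _ => ?_
    by_cases hD : Sat σ D
    · have key : ∀ τ : Perm α, (Sat (σ * τ⁻¹) C ∧ Sat σ D) ↔
          Sat τ (C.image (fun p => (σ⁻¹ p.2, p.1))) := by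
        intro τ
        rw [and_iff_left hD]
        simp only [Sat, mem_image, Perm.mul_apply]
        constructor
        · rintro h _ ⟨q, hq, rfl⟩
          simp [← h q hq]
        · intro h p hp
          have := h _ ⟨p, hp, rfl⟩
          simp only at this
          rw [← this]; simp
      simp only [ind_congr (key _)]
      exact hB _ (card_image_le.trans hC)
    · simp [hD, ind]

lemma pair_both {t : ℕ} {A B : Finset (Perm α)} (hA : SU (2 * t + 1) A) (hB : SU t B)
    (C D : Finset (α × α)) (h : #C + #D ≤ 2 * t + 1) :
    (∑ σ ∈ A, ∑ τ ∈ B, ind (Sat σ C ∧ Sat (σ * τ) D))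
        * ((Fintype.card α).factorial * (Fintype.card α).factorial)
      = #A * #B * ∑ σ : Perm α, ∑ τ : Perm α, ind (Sat σ C ∧ Sat τ D) := by
  have e : ∑ σ : Perm α, ∑ τ : Perm α, ind (Sat σ C ∧ Sat τ D)
      = ∑ σ : Perm α, ∑ τ : Perm α, ind (Sat σ C ∧ Sat (σ * τ) D) := by
    refine sum_congr rfl fun σ _ => ?_
    rw [← Equiv.sum_comp (Equiv.mulLeft σ) (fun τ => ind (Sat σ C ∧ Sat τ D))]
    simp
  rw [e, mul_assoc (#A), ← pair_right hB C D h, ← mul_assoc, ← mul_assoc]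
  congr 1
  rw [sum_comm, sum_comm (s := (univ : Finset (Perm α))), sum_mul, mul_sum]
  exact sum_congr rfl fun τ _ => pair_left hA C D h τ

/-- Splitting a constraint set on `α ⊕ α`. -/
lemma split (C : Finset ((α ⊕ α) × (α ⊕ α))) :
    (∀ σ τ : Perm α, ¬ Sat (Perm.sumCongr σ τ) C) ∨
    ∃ C₁ C₂ : Finset (α × α), #C₁ + #C₂ ≤ #C ∧
      ∀ σ τ : Perm α, Sat (Perm.sumCongr σ τ) C ↔ Sat σ C₁ ∧ Sat τ C₂ := by
  induction C using Finset.induction_on with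
  | empty => exact Or.inr ⟨∅, ∅, by simp, by simp [Sat]⟩
  | insert p C hp ih =>
    rcases ih with ih | ⟨C₁, C₂, hc, ih⟩
    · left
      intro σ τ h
      exact ih σ τ fun q hq => h q (mem_insert_of_mem hq)
    · have hs : ∀ σ τ : Perm α, Sat (Perm.sumCongr σ τ) (insert p C) ↔
          Perm.sumCongr σ τ p.1 = p.2 ∧ Sat σ C₁ ∧ Sat τ C₂ := by
        intro σ τ
        rw [← ih]
        simp [Sat]
      simp only [hs]
      rw [card_insert_of_notMem hp]
      obtain ⟨a | a, b | b⟩ := p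
      · right
        refine ⟨insert (a, b) C₁, C₂, ?_, ?_⟩
        · have := card_insert_le (a, b) C₁
          omega
        · intro σ τ
          simp [Sat, and_assoc]
      · left; simp
      · left; simp
      · right
        refine ⟨C₁, insert (a, b) C₂, ?_, ?_⟩
        · have := card_insert_le (a, b) C₂
          omega
        · intro σ τ
          simp [Sat, and_left_comm]

lemma pair_sum {t : ℕ} {A B : Finset (Perm α)} (hA : SU (2 * t + 1) A) (hB : SU t B)
    (C : Finset ((α ⊕ α) × (α ⊕ α))) (h : #C ≤ 2 * t + 1) (ρ : Perm (α ⊕ α)) :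
    (∑ σ ∈ A, ∑ τ ∈ B, ind (Sat (Perm.sumCongr σ (σ * τ) * ρ) C))
        * ((Fintype.card α).factorial * (Fintype.card α).factorial)
      = #A * #B * ∑ σ : Perm α, ∑ τ : Perm α, ind (Sat (Perm.sumCongr σ τ * ρ) C) := by
  have key : ∀ π : Perm (α ⊕ α), Sat (π * ρ) C ↔ Sat π (C.image (fun p => (ρ p.1, p.2))) := by
    intro π
    simp only [Sat, mem_image, Perm.mul_apply]
    constructor
    · rintro h _ ⟨q, hq, rfl⟩
      exact h q hq
    · intro h p hp
      exact h _ ⟨p, hp, rfl⟩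
  simp only [ind_congr (key _)]
  rcases split (C.image (fun p => (ρ p.1, p.2))) with hn | ⟨C₁, C₂, hc, hs⟩
  · simp [hn, ind]
  · simp only [ind_congr (hs _ _)]
    exact pair_both hA hB C₁ C₂ ((hc.trans card_image_le).trans h)

lemma exists_transversal (α : Type) [Fintype α] [DecidableEq α] :
    ∃ R : Finset (Perm (α ⊕ α)),
      Function.Bijective (fun x : (Perm α × Perm α) × R =>
        Perm.sumCongr x.1.1 x.1.2 * x.2.1) := by
  obtain ⟨S, hS, -⟩ := (Perm.sumCongrHom α α).range.exists_isComplement_right 1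
  classical
  refine ⟨S.toFinset, ?_⟩
  have hb : Function.Bijective (fun x : (Perm α × Perm α) × S.toFinset =>
      ((⟨Perm.sumCongrHom α α x.1, ⟨x.1, rfl⟩⟩ : (Perm.sumCongrHom α α).range),
        (⟨x.2.1, Set.mem_toFinset.1 x.2.2⟩ : S))) := by
    constructor
    · rintro ⟨a, b⟩ ⟨c, d⟩ h
      have h1 := congrArg (fun z => z.1.1) h
      have h2 := congrArg (fun z => z.2.1) h
      exact Prod.ext (Perm.sumCongrHom_injective h1) (Subtype.ext h2)
    · rintro ⟨⟨_, a, rfl⟩, ⟨b, hb⟩⟩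
      exact ⟨(a, ⟨b, by simpa using hb⟩), rfl⟩
  exact Function.Bijective.comp hS hb

lemma step {t a b : ℕ} {A B : Finset (Perm α)} (hA : SU (2 * t + 1) A) (hB : SU t B)
    (hA0 : A.Nonempty) (hB0 : B.Nonempty)
    (ha : #A ≤ a) (hb : #B ≤ b) :
    ∃ T : Finset (Perm (α ⊕ α)), T.Nonempty ∧ SU (2 * t + 1) T ∧
      #T ≤ 4 ^ Fintype.card α * a * b := by
  obtain ⟨R, hR⟩ := exists_transversal α
  set n := Fintype.card α with hn
  have hcard : (2 * n).factorial = n.factorial * n.factorial * #R := by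
    have := Fintype.card_of_bijective hR
    simp only [Fintype.card_prod, Fintype.card_coe, Fintype.card_perm, Fintype.card_sum] at this
    rw [this, two_mul]
  have hRc : #R = n.centralBinom := by
    have h1 := Nat.choose_mul_factorial_mul_factorial (show n ≤ 2 * n by omega)
    rw [show 2 * n - n = n by omega, hcard] at h1
    have : 0 < n.factorial * n.factorial := by positivity
    rw [Nat.centralBinom]
    refine (Nat.eq_of_mul_eq_mul_left this ?_).symm
    linarith
  have hinj : Function.Injective (fun x : (Perm α × Perm α) × R =>
        Perm.sumCongr x.1.1 (x.1.1 * x.1.2) * x.2.1) := by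
    rintro ⟨⟨x1, x2⟩, x3⟩ ⟨⟨y1, y2⟩, y3⟩ h
    have := hR.1 (a₁ := ((x1, x1 * x2), x3)) (a₂ := ((y1, y1 * y2), y3)) h
    simp only [Prod.mk.injEq] at this
    obtain ⟨⟨rfl, h2⟩, rfl⟩ := this
    rw [mul_left_cancel h2]
  refine ⟨((A ×ˢ B) ×ˢ (univ : Finset R)).image (fun x =>
        Perm.sumCongr x.1.1 (x.1.1 * x.1.2) * x.2.1), ?_, ?_, ?_⟩
  · have : 0 < #R := by rw [hRc]; exact Nat.centralBinom_pos n
    have : Nonempty R := by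
      obtain ⟨r, hr⟩ := card_pos.1 this
      exact ⟨r, hr⟩
    exact ((hA0.product hB0).product univ_nonempty).image _
  · intro C hC
    rw [card_image_of_injective _ hinj, sum_image (fun x _ y _ h => hinj h)]
    rw [← Function.Bijective.sum_comp hR (fun π => ind (Sat π C))]
    rw [← univ_product_univ, sum_product_right, sum_product_right,
      ← univ_product_univ]
    simp only [sum_product, card_product, card_univ, Fintype.card_coe]
    rw [Fintype.card_sum, ← two_mul, ← hn, hcard, ← mul_assoc, sum_mul, mul_sum, sum_mul]
    refine sum_congr rfl fun ρ _ => ?_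
    rw [pair_sum hA hB C hC]
    ring
  · rw [card_image_of_injective _ hinj, card_product, card_product, card_univ, Fintype.card_coe,
      hRc]
    have : n.centralBinom ≤ 4 ^ n := by
      rw [Nat.centralBinom, show 4 ^ n = 2 ^ (2 * n) by rw [pow_mul]; norm_num]
      exact Nat.choose_le_two_pow _ _
    calc #A * #B * n.centralBinom ≤ a * b * 4 ^ n := by gcongr
      _ = _ := by ring

lemma transfer {β : Type} [Fintype β] [DecidableEq β] (e : α ≃ β) {t : ℕ} {T : Finset (Perm α)}
    (hT : SU t T) : SU t (T.map e.permCongr.toEmbedding) := by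
  intro C hC
  have key : ∀ σ : Perm α, Sat (e.permCongr σ) C ↔
      Sat σ (C.image (fun p => (e.symm p.1, e.symm p.2))) := by
    intro σ
    simp only [Sat, mem_image, Equiv.permCongr_apply]
    constructor
    · rintro h _ ⟨q, hq, rfl⟩
      simp [← h q hq]
    · intro h p hp
      rw [h _ ⟨p, hp, rfl⟩]; simp
  rw [sum_map, card_map, ← Equiv.sum_comp e.permCongr, ← Fintype.card_congr e]
  simp only [Equiv.coe_toEmbedding, ind_congr (key _)]
  exact hT _ (card_image_le.trans hC)

lemma full_count (k : ℕ) (x y : Fin k ↪ α) :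
    (∑ σ : Perm α, ind (∀ m, σ (x m) = y m)) * (Fintype.card α).descFactorial k
      = (Fintype.card α).factorial := by
  have h1 : ∀ z : Fin k ↪ α, ∑ σ : Perm α, ind (∀ m, σ (x m) = z m)
      = ∑ σ : Perm α, ind (∀ m, σ (x m) = y m) := by
    intro z
    obtain ⟨g, hg⟩ := (Perm.isMultiplyPretransitive α k).exists_smul_eq y z
    rw [← Equiv.sum_comp (Equiv.mulLeft g)]
    refine sum_congr rfl fun σ _ => ind_congr (forall_congr' fun m => ?_)
    rw [← hg]
    simp
  have h2 : ∑ z : Fin k ↪ α, ∑ σ : Perm α, ind (∀ m, σ (x m) = z m)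
      = (Fintype.card α).factorial := by
    rw [sum_comm, ← Fintype.card_perm, Fintype.card_eq_sum_ones]
    refine sum_congr rfl fun σ _ => ?_
    rw [Finset.sum_eq_single (x.trans σ.toEmbedding)]
    · simp [ind]
    · intro z _ hz
      rw [ind, if_neg]
      intro h
      exact hz (by ext m; simp [h])
    · simp
  simp only [h1] at h2
  rw [sum_const, card_univ, Fintype.card_embedding_eq, Fintype.card_fin] at h2
  rw [mul_comm]
  simpa using h2

end

lemma base_one (n : ℕ) [NeZero n] :
    ∃ T : Finset (Perm (Fin n)), T.Nonempty ∧ SU 1 T ∧ #T ≤ n := by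
  have hinj : Function.Injective (fun a : Fin n => Equiv.addRight a) := by
    intro a b h
    have := congrArg (fun f : Perm (Fin n) => f 0) h
    simpa using this
  refine ⟨univ.image (fun a : Fin n => Equiv.addRight a), univ_nonempty.image _, ?_, ?_⟩
  · intro C hC
    rw [card_image_of_injective _ hinj, sum_image (fun x _ y _ h => hinj h)]
    rcases Nat.le_one_iff_eq_zero_or_eq_one.1 hC with h | h
    · rw [card_eq_zero] at h
      subst h
      simp [Sat, ind, Fintype.card_perm]
    · obtain ⟨⟨p, q⟩, rfl⟩ := card_eq_one.1 h
      have : (∑ σ : Perm (Fin n), ind (Fin 1 → σ p = q)) * (Fintype.card (Fin n)).descFactorial 1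
          = (Fintype.card (Fin n)).factorial := full_count (α := Fin n) 1 ⟨fun _ => p, fun _ _ _ => Subsingleton.elim _ _⟩
        ⟨fun _ => q, fun _ _ _ => Subsingleton.elim _ _⟩
      have key : ∀ σ : Perm (Fin n), (Fin 1 → σ p = q) ↔ σ p = q :=
        fun σ => ⟨fun h => h 0, fun h _ => h⟩
      rw [Nat.descFactorial_one, sum_congr rfl fun σ _ => ind_congr (key σ)] at this
      simp only [Sat, mem_singleton, forall_eq]
      rw [mul_comm (#_), card_univ, this, sum_eq_single (q - p)]
      · simp [ind]
      · intro b _ hb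
        rw [ind, if_neg]
        simp only [Equiv.coe_addRight]
        intro h
        exact hb (by rw [← h]; simp)
      · simp
  · exact card_image_le.trans (by simp)

lemma SU_of_card_one (t : ℕ) : SU t (univ : Finset (Perm (Fin (2 ^ 0)))) := by
  intro C _
  rw [card_univ, Fintype.card_perm, mul_comm]

/-- The recursive construction. -/
lemma main_aux (l : ℕ) : ∀ m : ℕ, ∃ T : Finset (Perm (Fin (2 ^ m))), T.Nonempty ∧
    SU (2 ^ (l + 2) - 1) T ∧ #T ≤ (2 ^ (l + 2) - 1) ^ (2 * 2 ^ m) := by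
  -- the numerical step
  have num : ∀ t n b : ℕ, 4 ^ n * b ≤ (2 * t + 1) ^ (2 * n) →
      4 ^ n * (2 * t + 1) ^ (2 * n) * b ≤ (2 * t + 1) ^ (2 * (2 * n)) := by
    intro t n b h
    calc 4 ^ n * (2 * t + 1) ^ (2 * n) * b = (4 ^ n * b) * (2 * t + 1) ^ (2 * n) := by ring
      _ ≤ (2 * t + 1) ^ (2 * n) * (2 * t + 1) ^ (2 * n) := by gcongr
      _ = _ := by rw [← pow_add]; congr 1; ring
  -- the recursion in `m`, given the smaller level
  have recur : ∀ t : ℕ, (∀ m, ∃ B : Finset (Perm (Fin (2 ^ m))), B.Nonempty ∧ SU t B ∧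
      4 ^ (2 ^ m) * #B ≤ (2 * t + 1) ^ (2 * 2 ^ m)) →
      ∀ m, ∃ T : Finset (Perm (Fin (2 ^ m))), T.Nonempty ∧
        SU (2 * t + 1) T ∧ #T ≤ (2 * t + 1) ^ (2 * 2 ^ m) := by
    intro t hB m
    induction m with
    | zero =>
      refine ⟨univ, univ_nonempty, SU_of_card_one _, ?_⟩
      rw [card_univ, Fintype.card_perm, Fintype.card_fin]
      exact Nat.one_le_pow _ _ (by omega)
    | succ m ih =>
      obtain ⟨A, hA0, hA, hAc⟩ := ih
      obtain ⟨B, hB0, hB, hBc⟩ := hB m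
      obtain ⟨T, hT0, hT, hTc⟩ := step hA hB hA0 hB0 hAc le_rfl
      have e : Fin (2 ^ m) ⊕ Fin (2 ^ m) ≃ Fin (2 ^ (m + 1)) :=
        finSumFinEquiv.trans (finCongr (by ring))
      refine ⟨T.map e.permCongr.toEmbedding, hT0.map, transfer e hT, ?_⟩
      rw [card_map]
      rw [Fintype.card_fin] at hTc
      refine hTc.trans ((num _ _ _ hBc).trans (le_of_eq ?_))
      congr 1; ring
  induction l with
  | zero =>
    refine recur 1 fun m => ?_
    obtain ⟨T, h0, h1, h2⟩ := base_one (2 ^ m)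
    refine ⟨T, h0, h1, ?_⟩
    have : ∀ n : ℕ, 4 ^ n * n ≤ 9 ^ n := by
      intro n
      calc 4 ^ n * n ≤ 4 ^ n * 2 ^ n := by gcongr; exact Nat.lt_two_pow_self.le
        _ = 8 ^ n := by rw [← mul_pow]; norm_num
        _ ≤ 9 ^ n := by gcongr; norm_num
    calc 4 ^ 2 ^ m * #T ≤ 4 ^ 2 ^ m * 2 ^ m := by gcongr
      _ ≤ 9 ^ 2 ^ m := this _
      _ = _ := by rw [pow_mul]; norm_num
  | succ l ih =>
    have ht : 2 ^ (l + 1 + 2) - 1 = 2 * (2 ^ (l + 2) - 1) + 1 := by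
      have : 0 < 2 ^ (l + 2) := by positivity
      rw [show l + 1 + 2 = (l + 2) + 1 by ring, pow_succ]
      omega
    rw [ht]
    refine recur _ fun m => ?_
    obtain ⟨B, h0, h1, h2⟩ := ih m
    refine ⟨B, h0, h1, ?_⟩
    generalize 2 ^ (l + 2) - 1 = t at *
    calc 4 ^ 2 ^ m * #B ≤ 4 ^ 2 ^ m * t ^ (2 * 2 ^ m) := by gcongr
      _ = (2 * t) ^ (2 * 2 ^ m) := by rw [mul_pow, pow_mul 2 2]; norm_num
      _ ≤ _ := by gcongr; omega

/-- For all integers `m ≥ 1` and `ℓ ≥ 2`, with `n = 2^m` and `t = 2^ℓ − 1`, there is a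
`min(t,n)`-wise uniform set of permutations on `n` objects of size at most `t^(2n)`. -/
theorem exists_small_twise_uniform (m l : ℕ) (hm : 1 ≤ m) (hl : 2 ≤ l) :
    ∃ T : Finset (Equiv.Perm (Fin (2 ^ m))),
      IsTwiseUniform (2 ^ m) (min (2 ^ l - 1) (2 ^ m)) T ∧
      T.card ≤ (2 ^ l - 1) ^ (2 * 2 ^ m) := by
  obtain ⟨l, rfl⟩ := Nat.exists_eq_add_of_le' hl
  obtain ⟨T, h0, h1, h2⟩ := main_aux l m
  refine ⟨T, ⟨h0, ?_⟩, h2⟩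
  intro i j hi hj
  have hk : min (2 ^ (l + 2) - 1) (2 ^ m) ≤ 2 ^ (l + 2) - 1 := min_le_left _ _
  generalize min (2 ^ (l + 2) - 1) (2 ^ m) = k at *
  have hf := full_count (α := Fin (2 ^ m)) k ⟨i, hi⟩ ⟨j, hj⟩
  have hs := h1 (univ.image fun a => (i a, j a)) (card_image_le.trans (by simpa using hk))
  have key : ∀ σ : Perm (Fin (2 ^ m)),
      Sat σ (univ.image fun a => (i a, j a)) ↔ ∀ a, σ (i a) = j a := by
    intro σ
    simp [Sat]
  simp only [ind_congr (key _)] at hs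
  simp only [Function.Embedding.coeFn_mk, Fintype.card_fin] at hf hs
  have hc : (T.filter (fun σ => ∀ m, σ (i m) = j m)).card
      = ∑ σ ∈ T, ind (∀ a, σ (i a) = j a) := by
    rw [card_filter]
    refine sum_congr rfl fun σ _ => ?_
    rw [ind]
    congr
  rw [hc]
  have hpos : 0 < (2 ^ m).factorial := Nat.factorial_pos _
  refine Nat.eq_of_mul_eq_mul_right hpos ?_
  rw [mul_right_comm, hs, mul_assoc, hf]
end

section
/- Let n ≥ 1 and t ≥ 0 be integers with 2t+1 ≤ n, let A be a t-wise uniform set of permutations of {1,…,n}, let B be a (2t+1)-wise uniform set of permutations of {1,…,n}, and let 𝒮 be a (2n,2t+1)-selection. For each S ∈ 𝒮 fix bijections f_S : S → {1,…,n} and g_S : S^c → {1,…,n}, where S^c is the complement of S in {1,…,2n}. Then the set M = {μ_{S,σ,τ} : S ∈ 𝒮, σ ∈ A, τ ∈ B} is a (2t+1)-wise uniform set of permutations of {1,…,2n}. -/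
/-- A `(2n,t)`-selection: a nonempty family `𝒮` of `n`-element subsets of `Fin (2n)` such that
for every `t`-element subset `I` and every `J ⊆ I`,
`|{S ∈ 𝒮 : J ⊆ S, (I∖J) ∩ S = ∅}| · C(2n,n) = |𝒮| · C(2n−t, n−|J|)`. -/
def IsSelection (n t : ℕ) (𝒮 : Finset (Finset (Fin (2 * n)))) : Prop :=
  𝒮.Nonempty ∧ (∀ S ∈ 𝒮, S.card = n) ∧
    ∀ I J : Finset (Fin (2 * n)), I.card = t → J ⊆ I →
      (𝒮.filter (fun S => J ⊆ S ∧ Disjoint (I \ J) S)).card * Nat.choose (2 * n) n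
        = 𝒮.card * Nat.choose (2 * n - t) (n - J.card)

/-- The permutation `μ_{S,σ,τ}` of `Fin (2n)`: on `S` it acts by `x ↦ τ(σ(f(x)))` (landing in
the first `n` values) and on `Sᶜ` by `x ↦ τ(g(x)) + n`. -/
def mu (n : ℕ) (S : Finset (Fin (2 * n)))
    (f : {x // x ∈ S} ≃ Fin n) (g : {x // x ∉ S} ≃ Fin n)
    (σ τ : Equiv.Perm (Fin n)) : Equiv.Perm (Fin (2 * n)) :=
  ((Equiv.sumCompl (· ∈ S)).symm.trans
    (Equiv.sumCongr (f.trans (σ.trans τ)) (g.trans τ))).trans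
    (finSumFinEquiv.trans (finCongr (two_mul n).symm))

open Finset in
lemma perm_count {n : ℕ} {ι : Type*} [Fintype ι] (x y : ι → Fin n)
    (hx : Function.Injective x) (hy : Function.Injective y) :
    ((univ : Finset (Equiv.Perm (Fin n))).filter (fun ρ => ∀ m, ρ (x m) = y m)).card
      = Nat.factorial (n - Fintype.card ι) := by
  classical
  obtain ⟨ρ0, h0⟩ : ∃ ρ0 : Equiv.Perm (Fin n), ∀ m, ρ0 (x m) = y m := by
    let e : {a // a ∈ Set.range x} ≃ {a // a ∈ Set.range y} :=
      (Equiv.ofInjective x hx).symm.trans (Equiv.ofInjective y hy)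
    refine ⟨e.extendSubtype, fun m => ?_⟩
    rw [Equiv.extendSubtype_apply_of_mem e (x m) ⟨m, rfl⟩]
    have : (⟨x m, ⟨m, rfl⟩⟩ : {a // a ∈ Set.range x}) = Equiv.ofInjective x hx m := rfl
    rw [this]
    simp [e]
  have h1 : ((univ : Finset (Equiv.Perm (Fin n))).filter (fun ρ => ∀ m, ρ (x m) = y m)).card
      = Fintype.card {ρ : Equiv.Perm (Fin n) // ∀ a, ¬ (a ∉ Set.range x) → ρ a = a} := by
    rw [Fintype.card_subtype]
    refine Finset.card_bij' (fun ρ _ => ρ0⁻¹ * ρ) (fun ρ _ => ρ0 * ρ) ?_ ?_ ?_ ?_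
    · intro ρ hρ
      simp only [mem_filter, mem_univ, true_and, not_not] at hρ ⊢
      rintro a ⟨m, rfl⟩
      rw [Equiv.Perm.mul_apply, hρ, ← h0]; simp
    · intro ρ hρ
      simp only [mem_filter, mem_univ, true_and, not_not] at hρ ⊢
      intro m
      rw [Equiv.Perm.mul_apply, hρ _ ⟨m, rfl⟩, h0]
    · intro ρ _; simp
    · intro ρ _; simp
  rw [h1, ← Fintype.card_congr (Equiv.Perm.subtypeEquivSubtypePerm (fun a => a ∉ Set.range x)),
    Fintype.card_perm, Fintype.card_subtype_compl, Fintype.card_fin]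
  congr 2
  exact (Fintype.card_congr (Equiv.ofInjective x hx)).symm

open Finset in
lemma unif_sum {n s : ℕ} {T : Finset (Equiv.Perm (Fin n))} (hT : IsTwiseUniform n s T)
    (hs : s ≤ n) (X : Finset (Fin n)) (hX : X.card ≤ s) (F : Equiv.Perm (Fin n) → ℕ)
    (hF : ∀ σ σ' : Equiv.Perm (Fin n), (∀ a ∈ X, σ a = σ' a) → F σ = F σ') :
    (∑ σ ∈ T, F σ) * n.factorial = T.card * ∑ σ, F σ := by
  classical
  obtain ⟨X', hXX', hX'⟩ := Finset.exists_superset_card_eq hX (by simpa using hs)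
  let i : Fin s → Fin n := X'.orderEmbOfFin hX'
  have hi : Function.Injective i := (X'.orderEmbOfFin hX').injective
  have hiX : ∀ a ∈ X, ∃ m, i m = a := by
    intro a ha
    have : a ∈ Set.range i := by
      simp only [i, Finset.range_orderEmbOfFin]
      exact hXX' ha
    exact this
  let r : Equiv.Perm (Fin n) → (Fin s → Fin n) := fun σ => σ ∘ i
  rw [← Finset.sum_fiberwise T r F, ← Finset.sum_fiberwise univ r F, Finset.sum_mul,
    Finset.mul_sum]
  refine Finset.sum_congr rfl fun j _ => ?_
  by_cases hj : ∃ σ0, r σ0 = j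
  · obtain ⟨σ0, h0⟩ := hj
    have hjinj : Function.Injective j := by
      rw [← h0]; exact σ0.injective.comp hi
    have hconst : ∀ U : Finset (Equiv.Perm (Fin n)),
        ∑ σ ∈ U with r σ = j, F σ = (U.filter (fun σ => ∀ m, σ (i m) = j m)).card * F σ0 := by
      intro U
      have : U.filter (fun σ => r σ = j) = U.filter (fun σ => ∀ m, σ (i m) = j m) := by
        ext σ; simp [r, funext_iff]
      rw [← this]
      rw [Finset.sum_congr rfl (g := fun _ => F σ0), Finset.sum_const, smul_eq_mul]
      intro σ hσ
      apply hF
      intro a ha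
      obtain ⟨m, rfl⟩ := hiX a ha
      exact congrFun ((mem_filter.1 hσ).2.trans h0.symm) m
    have hpc : ((univ : Finset (Equiv.Perm (Fin n))).filter (fun ρ => ∀ m, ρ (i m) = j m)).card
        = Nat.factorial (n - Fintype.card (Fin s)) := by
      convert perm_count i j hi hjinj
    rw [hconst, hconst, hpc, ← hT.2 i j hi hjinj, Fintype.card_fin,
      ← Nat.factorial_mul_descFactorial hs]
    ring
  · have hne : ∀ U : Finset (Equiv.Perm (Fin n)), U.filter (fun σ => r σ = j) = ∅ := by
      intro U
      apply Finset.filter_eq_empty_iff.2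
      intro σ _ h
      exact hj ⟨σ, h⟩
    rw [hne, hne]; simp

open Finset in
lemma unif_inv {n s : ℕ} {T : Finset (Equiv.Perm (Fin n))} (hT : IsTwiseUniform n s T) :
    IsTwiseUniform n s (T.map (Equiv.inv (Equiv.Perm (Fin n))).toEmbedding) := by
  refine ⟨by simpa using hT.1, fun i j hi hj => ?_⟩
  rw [card_map, ← hT.2 j i hj hi, Finset.filter_map, card_map]
  congr 2
  ext σ
  simp only [mem_filter, Function.comp, Equiv.coe_toEmbedding, Equiv.inv_apply,
    Equiv.Perm.inv_eq_iff_eq]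
  simp only [eq_comm]

open Finset in
lemma pair_count {n t : ℕ} (ht : 2 * t + 1 ≤ n) {A B : Finset (Equiv.Perm (Fin n))}
    (hA : IsTwiseUniform n t A) (hB : IsTwiseUniform n (2 * t + 1) B)
    {ι κ : Type*} [Fintype ι] [Fintype κ] (hc : Fintype.card ι + Fintype.card κ = 2 * t + 1)
    (x y : ι → Fin n) (z w : κ → Fin n)
    (hx : Function.Injective x) (hy : Function.Injective y)
    (hz : Function.Injective z) (hw : Function.Injective w) :
    ((A ×ˢ B).filter (fun q => (∀ m, q.2 (q.1 (x m)) = y m) ∧ ∀ k, q.2 (z k) = w k)).card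
      * (n.factorial * n.factorial)
      = A.card * B.card * ((n - Fintype.card ι).factorial * (n - Fintype.card κ).factorial) := by
  classical
  let P : Equiv.Perm (Fin n) → Equiv.Perm (Fin n) → Prop :=
    fun σ τ => (∀ m, τ (σ (x m)) = y m) ∧ ∀ k, τ (z k) = w k
  let G : Equiv.Perm (Fin n) → ℕ := fun σ => ∑ τ, if P σ τ then 1 else 0
  have hcard : ((A ×ˢ B).filter
      (fun q => (∀ m, q.2 (q.1 (x m)) = y m) ∧ ∀ k, q.2 (z k) = w k)).card
      = ∑ σ ∈ A, ∑ τ ∈ B, if P σ τ then 1 else 0 := by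
    rw [Finset.card_filter, Finset.sum_product]
  have h1 : ∀ σ, (∑ τ ∈ B, if P σ τ then 1 else 0) * n.factorial = B.card * G σ := by
    intro σ
    refine unif_sum hB ht (univ.image (fun m => σ (x m)) ∪ univ.image z) ?_ _ ?_
    · refine (card_union_le _ _).trans ?_
      rw [← hc]
      exact add_le_add card_image_le card_image_le
    · intro τ τ' h
      have e : P σ τ ↔ P σ τ' := by
        simp only [P]
        refine and_congr (forall_congr' fun m => ?_) (forall_congr' fun k => ?_)
        · rw [h _ (by simp)]
        · rw [h _ (by simp)]
      simp only [e]
  have h2 : (∑ σ ∈ A, G σ) * n.factorial = A.card * ∑ σ, G σ := by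
    have htn : t ≤ n := by omega
    by_cases hι : Fintype.card ι ≤ t
    · refine unif_sum hA htn (univ.image x) (card_image_le.trans hι) _ ?_
      intro σ σ' h
      have e : ∀ τ, P σ τ ↔ P σ' τ := by
        intro τ
        simp only [P]
        refine and_congr (forall_congr' fun m => ?_) Iff.rfl
        rw [h _ (by simp)]
      simp only [G, e]
    · have hκ : Fintype.card κ ≤ t := by omega
      have hG : ∀ σ, G σ⁻¹ = ∑ ρ : Equiv.Perm (Fin n),
          if (∀ m, ρ (x m) = y m) ∧ (∀ k, ρ (σ (z k)) = w k) then 1 else 0 := by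
        intro σ
        simp only [G]
        rw [← Equiv.sum_comp (Equiv.mulRight σ)]
        refine sum_congr rfl fun ρ _ => ?_
        simp [P]
      have h3 := unif_sum (unif_inv hA) htn (univ.image z) (card_image_le.trans hκ)
        (fun σ => G σ⁻¹) (by
          intro σ σ' h
          simp only [hG]
          refine sum_congr rfl fun ρ _ => ?_
          have e : ∀ k, σ (z k) = σ' (z k) := fun k => h _ (by simp)
          simp only [e])
      rw [sum_map, card_map] at h3
      simp only [Equiv.coe_toEmbedding, Equiv.inv_apply, inv_inv] at h3
      rw [h3]
      congr 1
      exact Equiv.sum_comp (Equiv.inv (Equiv.Perm (Fin n))) G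
  have h4 : ∑ σ, G σ
      = (n - Fintype.card ι).factorial * (n - Fintype.card κ).factorial := by
    simp only [G]
    rw [sum_comm, ← perm_count x y hx hy, ← perm_count z w hz hw, card_filter, card_filter,
      mul_sum]
    refine sum_congr rfl fun τ _ => ?_
    rw [← Equiv.sum_comp (Equiv.mulLeft τ) (fun ρ => if ∀ m, ρ (x m) = y m then 1 else 0),
      sum_mul]
    refine sum_congr rfl fun σ _ => ?_
    simp only [P, Equiv.coe_mulLeft, Equiv.Perm.mul_apply, ]
    by_cases c1 : ∀ m, τ (σ (x m)) = y m <;> by_cases c2 : ∀ k, τ (z k) = w k <;> simp [c1, c2]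
  rw [hcard, ← h4, ← mul_assoc, sum_mul]
  simp only [h1]
  rw [← mul_sum, mul_assoc, h2]
  ring

lemma mu_mem {n : ℕ} {S : Finset (Fin (2 * n))}
    (f : {x // x ∈ S} ≃ Fin n) (g : {x // x ∉ S} ≃ Fin n)
    (σ τ : Equiv.Perm (Fin n)) (a : Fin (2 * n)) (h : a ∈ S) :
    (mu n S f g σ τ a).val = (τ (σ (f ⟨a, h⟩))).val := by
  simp [mu, Equiv.sumCompl_symm_apply_of_pos h]

lemma mu_not_mem {n : ℕ} {S : Finset (Fin (2 * n))}
    (f : {x // x ∈ S} ≃ Fin n) (g : {x // x ∉ S} ≃ Fin n)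
    (σ τ : Equiv.Perm (Fin n)) (a : Fin (2 * n)) (h : a ∉ S) :
    (mu n S f g σ τ a).val = n + (τ (g ⟨a, h⟩)).val := by
  simp [mu, Equiv.sumCompl_symm_apply_of_neg h, add_comm]

lemma mu_lt_iff {n : ℕ} {S : Finset (Fin (2 * n))}
    (f : {x // x ∈ S} ≃ Fin n) (g : {x // x ∉ S} ≃ Fin n)
    (σ τ : Equiv.Perm (Fin n)) (a : Fin (2 * n)) :
    (mu n S f g σ τ a).val < n ↔ a ∈ S := by
  by_cases h : a ∈ S
  · simp [mu_mem f g σ τ a h, h]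
  · simp [mu_not_mem f g σ τ a h, h]

lemma mu_inj {n : ℕ} {S : Finset (Fin (2 * n))}
    (f : {x // x ∈ S} ≃ Fin n) (g : {x // x ∉ S} ≃ Fin n)
    (σ τ σ' τ' : Equiv.Perm (Fin n)) (h : mu n S f g σ τ = mu n S f g σ' τ') :
    σ = σ' ∧ τ = τ' := by
  have hτ : τ = τ' := by
    ext a
    obtain ⟨⟨b, hb⟩, rfl⟩ := g.surjective a
    have := congrArg Fin.val (Equiv.congr_fun h b)
    rw [mu_not_mem f g σ τ b hb, mu_not_mem f g σ' τ' b hb] at this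
    omega
  subst hτ
  refine ⟨?_, rfl⟩
  ext a
  obtain ⟨⟨b, hb⟩, rfl⟩ := f.surjective a
  have := congrArg Fin.val (Equiv.congr_fun h b)
  rw [mu_mem f g σ τ b hb, mu_mem f g σ' τ b hb] at this
  have := τ.injective (Fin.ext this)
  rw [this]

open Finset in
/-- The count for a fixed `S` that is compatible with the pattern of `j`. -/
lemma fixed_count {n t : ℕ} (ht : 2 * t + 1 ≤ n) {A B : Finset (Equiv.Perm (Fin n))}
    (hA : IsTwiseUniform n t A) (hB : IsTwiseUniform n (2 * t + 1) B)
    (S : Finset (Fin (2 * n)))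
    (f : {x // x ∈ S} ≃ Fin n) (g : {x // x ∉ S} ≃ Fin n)
    (i j : Fin (2 * t + 1) → Fin (2 * n))
    (hi : Function.Injective i) (hj : Function.Injective j)
    (a : ℕ) (ha : (univ.filter (fun m => (j m).val < n)).card = a)
    (hS : ∀ m, i m ∈ S ↔ (j m).val < n) :
    ((A ×ˢ B).filter (fun q => ∀ m, mu n S f g q.1 q.2 (i m) = j m)).card
      * (n.factorial * n.factorial)
      = A.card * B.card * ((n - a).factorial * (n - (2 * t + 1 - a)).factorial) := by
  classical
  let p : Fin (2 * t + 1) → Prop := fun m => (j m).val < n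
  have hcι : Fintype.card {m // p m} = a := by
    rw [Fintype.card_subtype]; exact ha
  have hcκ : Fintype.card {m // ¬ p m} = 2 * t + 1 - a := by
    rw [Fintype.card_subtype_compl, hcι, Fintype.card_fin]
  have hale : a ≤ 2 * t + 1 := by
    rw [← ha]; exact (card_le_univ _).trans (by simp)
  let x : {m // p m} → Fin n := fun m => f ⟨i m.1, (hS m.1).2 m.2⟩
  let y : {m // p m} → Fin n := fun m => ⟨(j m.1).val, m.2⟩
  let z : {m // ¬ p m} → Fin n := fun m => g ⟨i m.1, fun h => m.2 ((hS m.1).1 h)⟩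
  let w : {m // ¬ p m} → Fin n := fun m => ⟨(j m.1).val - n, by
    have := (j m.1).isLt; omega⟩
  have hx : Function.Injective x := by
    intro m m' h
    have := congrArg Subtype.val (f.injective h)
    exact Subtype.ext (hi this)
  have hz : Function.Injective z := by
    intro m m' h
    have := congrArg Subtype.val (g.injective h)
    exact Subtype.ext (hi this)
  have hy : Function.Injective y := by
    intro m m' h
    have := congrArg Fin.val h
    exact Subtype.ext (hj (Fin.ext this))
  have hw : Function.Injective w := by
    intro m m' h
    have := congrArg Fin.val h
    have h1 := m.2
    have h2 := m'.2
    simp only [p, w] at this h1 h2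
    exact Subtype.ext (hj (Fin.ext (by omega)))
  have key := pair_count ht hA hB (by rw [hcι, hcκ]; omega) x y z w hx hy hz hw
  rw [hcι, hcκ] at key
  rw [← key]
  congr 2
  ext q
  simp only [mem_filter]
  refine and_congr Iff.rfl ⟨fun h => ⟨fun m => ?_, fun m => ?_⟩, fun h m => ?_⟩
  · have := congrArg Fin.val (h m.1)
    rw [mu_mem f g _ _ _ ((hS m.1).2 m.2)] at this
    exact Fin.ext this
  · have := congrArg Fin.val (h m.1)
    rw [mu_not_mem f g _ _ _ (fun h => m.2 ((hS m.1).1 h))] at this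
    refine Fin.ext ?_
    simp only [z, w]
    omega
  · by_cases hm : p m
    · have := congrArg Fin.val (h.1 ⟨m, hm⟩)
      refine Fin.ext ?_
      rw [mu_mem f g _ _ _ ((hS m).2 hm)]
      exact this
    · have := congrArg Fin.val (h.2 ⟨m, hm⟩)
      refine Fin.ext ?_
      rw [mu_not_mem f g _ _ _ (fun h => hm ((hS m).1 h))]
      simp only [z, w] at this
      simp only [p] at hm
      omega

/-- If `A` is `t`-wise uniform on `n` elements, `B` is `(2t+1)`-wise uniform on `n` elements,
and `𝒮` is a `(2n,2t+1)`-selection, then `M = {μ_{S,σ,τ} : S ∈ 𝒮, σ ∈ A, τ ∈ B}` is a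
`(2t+1)`-wise uniform set of permutations on `2n` elements. -/
theorem mu_image_isTwiseUniform (n t : ℕ) (hn : 1 ≤ n) (ht : 2 * t + 1 ≤ n)
    (A B : Finset (Equiv.Perm (Fin n)))
    (hA : IsTwiseUniform n t A) (hB : IsTwiseUniform n (2 * t + 1) B)
    (𝒮 : Finset (Finset (Fin (2 * n)))) (h𝒮 : IsSelection n (2 * t + 1) 𝒮)
    (f : (S : Finset (Fin (2 * n))) → S ∈ 𝒮 → ({x // x ∈ S} ≃ Fin n))
    (g : (S : Finset (Fin (2 * n))) → S ∈ 𝒮 → ({x // x ∉ S} ≃ Fin n)) :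
    IsTwiseUniform (2 * n) (2 * t + 1)
      ((𝒮.attach ×ˢ A ×ˢ B).image
        (fun q => mu n q.1.1 (f q.1.1 q.1.2) (g q.1.1 q.1.2) q.2.1 q.2.2)) := by
  classical
  obtain ⟨hSne, hScard, hSsel⟩ := h𝒮
  have hinj : Function.Injective
      (fun q : {x // x ∈ 𝒮} × Equiv.Perm (Fin n) × Equiv.Perm (Fin n) =>
        mu n q.1.1 (f q.1.1 q.1.2) (g q.1.1 q.1.2) q.2.1 q.2.2) := by
    rintro ⟨⟨S, hS⟩, σ, τ⟩ ⟨⟨S', hS'⟩, σ', τ'⟩ h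
    simp only at h
    have hSS : S = S' := by
      ext a
      rw [← mu_lt_iff (f S hS) (g S hS) σ τ a, h, mu_lt_iff]
    subst hSS
    obtain ⟨rfl, rfl⟩ := mu_inj (f S hS) (g S hS) σ τ σ' τ' h
    rfl
  refine ⟨?_, fun i j hi hj => ?_⟩
  · exact ((Finset.attach_nonempty_iff.2 hSne).product (hA.1.product hB.1)).image _
  rw [Finset.card_image_of_injective _ hinj, Finset.filter_image,
    Finset.card_image_of_injective _ hinj, Finset.card_product, Finset.card_product,
    Finset.card_attach]
  obtain ⟨a, ha⟩ : ∃ a, (Finset.univ.filter (fun m => (j m).val < n)).card = a := ⟨_, rfl⟩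
  have hale : a ≤ 2 * t + 1 := by
    rw [← ha]; exact (Finset.card_le_univ _).trans (by simp)
  set N := (Finset.filter (fun q : {x // x ∈ 𝒮} × Equiv.Perm (Fin n) × Equiv.Perm (Fin n) =>
    ∀ m, (mu n q.1.1 (f q.1.1 q.1.2) (g q.1.1 q.1.2) q.2.1 q.2.2) (i m) = j m)
    (𝒮.attach ×ˢ A ×ˢ B)).card with hN
  let fit : Finset (Fin (2 * n)) → Prop := fun S => ∀ m, i m ∈ S ↔ (j m).val < n
  have hNsum : N = ∑ S ∈ 𝒮.attach, ((A ×ˢ B).filter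
      (fun q => ∀ m, mu n S.1 (f S.1 S.2) (g S.1 S.2) q.1 q.2 (i m) = j m)).card := by
    rw [hN, Finset.card_filter, Finset.sum_product]
    refine Finset.sum_congr rfl fun S _ => ?_
    rw [Finset.card_filter]
  set K := A.card * B.card * ((n - a).factorial * (n - (2 * t + 1 - a)).factorial) with hK
  have h1 : N * (n.factorial * n.factorial) = (𝒮.filter fit).card * K := by
    rw [hNsum, Finset.sum_mul, Finset.card_filter, Finset.sum_mul,
      ← Finset.sum_attach 𝒮 (fun S => (if fit S then 1 else 0) * K)]
    refine Finset.sum_congr rfl fun S _ => ?_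
    by_cases hS : fit S.1
    · rw [if_pos hS, one_mul]
      exact fixed_count ht hA hB S.1 (f S.1 S.2) (g S.1 S.2) i j hi hj a ha hS
    · rw [if_neg hS, zero_mul, Finset.filter_eq_empty_iff.2, Finset.card_empty, zero_mul]
      intro q _ h
      refine hS fun m => ?_
      rw [← h m, mu_lt_iff]
  have h2 : (𝒮.filter fit).card * Nat.choose (2 * n) n
      = 𝒮.card * Nat.choose (2 * n - (2 * t + 1)) (n - a) := by
    have h := hSsel (Finset.univ.image i)
      ((Finset.univ.filter (fun m => (j m).val < n)).image i)
      (by rw [Finset.card_image_of_injective _ hi]; simp)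
      (Finset.image_subset_image (Finset.subset_univ _))
    rw [Finset.card_image_of_injective _ hi, ha] at h
    rw [← h]
    congr 2
    ext S
    simp only [Finset.mem_filter, fit]
    refine and_congr Iff.rfl ⟨fun h => ⟨?_, ?_⟩, fun h m => ⟨fun hm => ?_, fun hm => ?_⟩⟩
    · intro b hb
      obtain ⟨m, hm, rfl⟩ := Finset.mem_image.1 hb
      exact (h m).2 (Finset.mem_filter.1 hm).2
    · rw [Finset.disjoint_left]
      intro b hb hbS
      obtain ⟨hb1, hb2⟩ := Finset.mem_sdiff.1 hb
      obtain ⟨m, hm, rfl⟩ := Finset.mem_image.1 hb1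
      exact hb2 (Finset.mem_image_of_mem _ (by simpa using (h m).1 hbS))
    · by_contra hlt
      refine Finset.disjoint_left.1 h.2 (Finset.mem_sdiff.2 ⟨?_, ?_⟩) hm
      · simp
      · intro hb
        obtain ⟨m', hm', e⟩ := Finset.mem_image.1 hb
        rw [hi e] at hm'
        exact hlt (Finset.mem_filter.1 hm').2
    · exact h.1 (Finset.mem_image_of_mem _ (by simpa using hm))
  have h3 : Nat.choose (2 * n) n * (n.factorial * n.factorial) = (2 * n).factorial := by
    have := Nat.choose_mul_factorial_mul_factorial (show n ≤ 2 * n by omega)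
    rw [show 2 * n - n = n by omega] at this
    rw [← this]; ring
  have h4 : Nat.choose (2 * n - (2 * t + 1)) (n - a)
      * ((n - a).factorial * (n - (2 * t + 1 - a)).factorial)
      = (2 * n - (2 * t + 1)).factorial := by
    have := Nat.choose_mul_factorial_mul_factorial
      (show n - a ≤ 2 * n - (2 * t + 1) by omega)
    rw [show 2 * n - (2 * t + 1) - (n - a) = n - (2 * t + 1 - a) by omega] at this
    rw [← this]; ring
  have h5 := Nat.factorial_mul_descFactorial (show 2 * t + 1 ≤ 2 * n by omega)
  refine Nat.eq_of_mul_eq_mul_left (Nat.factorial_pos (2 * n - (2 * t + 1))) ?_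
  calc (2 * n - (2 * t + 1)).factorial * (N * (2 * n).descFactorial (2 * t + 1))
      = N * (2 * n).factorial := by rw [← h5]; ring
    _ = (N * (n.factorial * n.factorial)) * Nat.choose (2 * n) n := by rw [← h3]; ring
    _ = ((𝒮.filter fit).card * Nat.choose (2 * n) n) * K := by rw [h1]; ring
    _ = _ := by rw [h2, hK, ← h4]; ring
end

section
/- Let n ≥ 1 and t ≥ 0 be integers with 2t+1 ≤ n. If there exists a t-wise uniform set A of permutations of {1,…,n} and a (2t+1)-wise uniform set B of permutations of {1,…,n}, then there exists a (2t+1)-wise uniform set of permutations of {1,…,2n} of cardinality at most C(2n,n) · |A| · |B|, where C(2n,n) is the binomial coefficient. -/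
open Finset in
/-- Any injective tuple can be moved to any other one by a permutation. -/
lemma exists_perm_tuple {n t : ℕ} (i j : Fin t → Fin n) (hi : Function.Injective i)
    (hj : Function.Injective j) : ∃ τ : Equiv.Perm (Fin n), ∀ m, τ (i m) = j m := by
  have h := Equiv.Perm.isMultiplyPretransitive (Fin n) t
  obtain ⟨g, hg⟩ := h.exists_smul_eq ⟨i, hi⟩ ⟨j, hj⟩
  refine ⟨g, fun m => ?_⟩
  have := DFunLike.congr_fun hg m
  simpa using this

open Finset in
/-- The full symmetric group is uniform. -/
lemma univ_uniform {n t : ℕ} (i j : Fin t → Fin n) (hi : Function.Injective i)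
    (hj : Function.Injective j) :
    ((univ : Finset (Equiv.Perm (Fin n))).filter (fun σ => ∀ m, σ (i m) = j m)).card
      * Nat.descFactorial n t = n.factorial := by
  have key : ∀ j' : Fin t ↪ Fin n,
      ((univ : Finset (Equiv.Perm (Fin n))).filter
        (fun σ => (⟨fun m => σ (i m), σ.injective.comp hi⟩ : Fin t ↪ Fin n) = j')).card =
      ((univ : Finset (Equiv.Perm (Fin n))).filter (fun σ => ∀ m, σ (i m) = j m)).card := by
    intro j'
    obtain ⟨τ, hτ⟩ := exists_perm_tuple j' j j'.injective hj
    refine Finset.card_bij' (fun σ _ => τ * σ) (fun σ _ => τ⁻¹ * σ) ?_ ?_ ?_ ?_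
    · intro σ hσ
      simp only [mem_filter, mem_univ, true_and] at hσ ⊢
      intro m
      have := DFunLike.congr_fun hσ m
      simp only [Function.Embedding.coeFn_mk] at this
      simp [this, hτ]
    · intro σ hσ
      simp only [mem_filter, mem_univ, true_and] at hσ ⊢
      ext m
      simp [hσ, ← hτ]
    · intro σ _; simp
    · intro σ _; simp
  have h := Finset.card_eq_sum_card_fiberwise (s := (univ : Finset (Equiv.Perm (Fin n))))
    (t := (univ : Finset (Fin t ↪ Fin n)))
    (f := fun σ => (⟨fun m => σ (i m), σ.injective.comp hi⟩ : Fin t ↪ Fin n))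
    (fun _ _ => by simp)
  rw [Finset.sum_congr rfl (fun j' _ => key j')] at h
  simp only [card_univ, Fintype.card_perm, Fintype.card_fin, sum_const,
    Fintype.card_embedding_eq, smul_eq_mul] at h
  rw [h, mul_comm]

open Finset in
/-- A predicate depending on at most `t` values has the right density. -/
lemma local_density {n t : ℕ} (htn : t ≤ n) {T : Finset (Equiv.Perm (Fin n))}
    (hT : IsTwiseUniform n t T) (P : Equiv.Perm (Fin n) → Prop) [DecidablePred P]
    (X : Finset (Fin n)) (hX : X.card ≤ t)
    (hP : ∀ σ τ : Equiv.Perm (Fin n), (∀ x ∈ X, σ x = τ x) → P σ → P τ) :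
    (T.filter P).card * n.factorial =
      T.card * ((univ : Finset (Equiv.Perm (Fin n))).filter P).card := by
  obtain ⟨Y, hXY, hY⟩ := Finset.exists_superset_card_eq (s := X) hX (by simpa using htn)
  let i : Fin t → Fin n := fun m => Y.orderEmbOfFin hY m
  have hi : Function.Injective i := (Y.orderEmbOfFin hY).injective
  have hiY : ∀ x ∈ X, ∃ m, i m = x := by
    intro x hx
    have : x ∈ Set.range (Y.orderEmbOfFin hY) := by
      rw [Finset.range_orderEmbOfFin]; exact hXY hx
    exact this
  have fib : ∀ U : Finset (Equiv.Perm (Fin n)), (U.filter P).card =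
      ∑ j : Fin t → Fin n, ((U.filter P).filter (fun σ => (fun m => σ (i m)) = j)).card :=
    fun U => Finset.card_eq_sum_card_fiberwise (fun _ _ => by simp)
  rw [fib T, fib univ, Finset.sum_mul, Finset.mul_sum]
  refine Finset.sum_congr rfl fun j _ => ?_
  by_cases h : ∃ τ, P τ ∧ ∀ m, τ (i m) = j m
  · obtain ⟨τ, hτ, hτj⟩ := h
    have hj : Function.Injective j := by
      have : j = fun m => τ (i m) := by funext m; exact (hτj m).symm
      rw [this]; exact τ.injective.comp hi
    have e : ∀ U : Finset (Equiv.Perm (Fin n)),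
        (U.filter P).filter (fun σ => (fun m => σ (i m)) = j) =
        U.filter (fun σ => ∀ m, σ (i m) = j m) := by
      intro U
      ext σ
      simp only [mem_filter, funext_iff]
      constructor
      · rintro ⟨⟨h1, _⟩, h2⟩; exact ⟨h1, h2⟩
      · rintro ⟨h1, h2⟩
        refine ⟨⟨h1, hP τ σ ?_ hτ⟩, h2⟩
        intro x hx
        obtain ⟨m, rfl⟩ := hiY x hx
        rw [hτj, h2]
    rw [e, e, ← univ_uniform i j hi hj, ← hT.2 i j hi hj]
    ring
  · have e : ∀ U : Finset (Equiv.Perm (Fin n)),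
        (U.filter P).filter (fun σ => (fun m => σ (i m)) = j) = ∅ := by
      intro U
      rw [Finset.filter_eq_empty_iff]
      intro σ hσ hh
      exact h ⟨σ, (mem_filter.1 hσ).2, fun m => congrFun hh m⟩
    rw [e, e]; simp

open Finset in
/-- Density for pairs. -/
lemma pair_density {n t : ℕ} (ht : 2 * t + 1 ≤ n) {A B : Finset (Equiv.Perm (Fin n))}
    (hA : IsTwiseUniform n t A) (hB : IsTwiseUniform n (2 * t + 1) B)
    (p q : Fin (2 * t + 1) → Fin n ⊕ Fin n) :
    ((A ×ˢ B).filter (fun ab => ∀ m, Equiv.sumCongr ab.2 (ab.1 * ab.2) (p m) = q m)).card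
      * (n.factorial * n.factorial) =
    (A.card * B.card) * ((univ : Finset (Equiv.Perm (Fin n) × Equiv.Perm (Fin n))).filter
      (fun ab => ∀ m, Equiv.sumCongr ab.2 (ab.1 * ab.2) (p m) = q m)).card := by
  classical
  have hd : ∀ (U V : Finset (Equiv.Perm (Fin n)))
      (R : Equiv.Perm (Fin n) → Equiv.Perm (Fin n) → Prop) [∀ a b, Decidable (R a b)],
      ((U ×ˢ V).filter (fun ab => R ab.1 ab.2)).card = ∑ a ∈ U, (V.filter (R a)).card := by
    intro U V R _
    simp only [Finset.card_filter]
    rw [Finset.sum_product]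
  have hd2 : ∀ (U V : Finset (Equiv.Perm (Fin n)))
      (R : Equiv.Perm (Fin n) → Equiv.Perm (Fin n) → Prop) [∀ a b, Decidable (R a b)],
      ∑ a ∈ U, (V.filter (R a)).card = ∑ b ∈ V, (U.filter (fun a => R a b)).card := by
    intro U V R _
    simp only [Finset.card_filter]
    rw [Finset.sum_comm]
  let R : Equiv.Perm (Fin n) → Equiv.Perm (Fin n) → Prop :=
    fun a b => ∀ m, Equiv.sumCongr b (a * b) (p m) = q m
  have step1 : ∀ a, (B.filter (R a)).card * n.factorial =
      B.card * ((univ : Finset (Equiv.Perm (Fin n))).filter (R a)).card := by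
    intro a
    refine local_density ht hB (R a) (univ.image (fun m => Sum.elim id id (p m))) ?_ ?_
    · exact card_image_le.trans (by simp)
    · intro σ τ h hσ m
      rw [← hσ m]
      have := h (Sum.elim id id (p m)) (mem_image_of_mem _ (mem_univ m))
      rcases hp : p m with x | x <;> simp [hp] at this <;> simp [this]
  have step2 : (∑ a ∈ A, ((univ : Finset (Equiv.Perm (Fin n))).filter (R a)).card)
      * n.factorial = A.card * ∑ a, ((univ : Finset (Equiv.Perm (Fin n))).filter (R a)).card := by
    have hkl : (univ.filter (fun m => (p m).isLeft = true)).card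
        + (univ.filter (fun m => ¬ (p m).isLeft = true)).card = 2 * t + 1 := by
      rw [Finset.card_filter_add_card_filter_not]; simp
    have htn : t ≤ n := by omega
    by_cases hk : (univ.filter (fun m => (p m).isLeft = true)).card ≤ t
    · have re : ∀ a, ((univ : Finset (Equiv.Perm (Fin n))).filter (R a)).card =
          ((univ : Finset (Equiv.Perm (Fin n))).filter (fun d => R a (a⁻¹ * d))).card := by
        intro a
        refine Finset.card_bij' (fun σ _ => a * σ) (fun σ _ => a⁻¹ * σ) ?_ ?_ ?_ ?_
        · intro σ hσ
          simpa using hσ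
        · intro σ hσ
          simpa using hσ
        · intro σ _; simp
        · intro σ _; simp
      simp only [re]
      rw [hd2 A univ (fun a d => R a (a⁻¹ * d)), hd2 univ univ (fun a d => R a (a⁻¹ * d)),
        Finset.sum_mul, Finset.mul_sum]
      refine Finset.sum_congr rfl fun d _ => ?_
      refine local_density htn hA (fun a => R a (a⁻¹ * d))
        ((univ.filter (fun m => (p m).isLeft = true)).image (fun m => Sum.elim id id (q m)))
        (card_image_le.trans hk) ?_
      intro σ τ h hσ m
      have hm := hσ m
      rcases hp : p m with x | x
      · have h1 := h (Sum.elim id id (q m)) (mem_image_of_mem _ (by simp [hp]))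
        rw [hp] at hm
        rcases hq : q m with u | u
        · simp only [hq, Sum.elim_inl, id] at h1
          rw [hq] at hm
          simp only [Equiv.sumCongr_apply, Sum.map_inl, Sum.inl.injEq, Equiv.Perm.mul_apply]
            at hm ⊢
          rw [Equiv.Perm.inv_eq_iff_eq] at hm ⊢
          rw [← h1]; exact hm
        · rw [hq] at hm
          simp at hm
      · rw [hp] at hm
        rw [← hm]
        simp
    · have hl : (univ.filter (fun m => ¬ (p m).isLeft = true)).card ≤ t := by omega
      rw [hd2 A univ R, hd2 univ univ R, Finset.sum_mul, Finset.mul_sum]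
      refine Finset.sum_congr rfl fun b _ => ?_
      refine local_density htn hA (fun a => R a b)
        ((univ.filter (fun m => ¬ (p m).isLeft = true)).image
          (fun m => b (Sum.elim id id (p m))))
        (card_image_le.trans hl) ?_
      intro σ τ h hσ m
      rw [← hσ m]
      rcases hp : p m with x | x
      · simp
      · have h1 := h (b (Sum.elim id id (p m))) (mem_image_of_mem (fun m => b (Sum.elim id id (p m))) (by simp [hp]))
        simp only [hp, Sum.elim_inr, id] at h1
        simp [h1]
  have e1 := hd A B R
  have e2 := hd univ univ R
  rw [Finset.univ_product_univ] at e2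
  have s1 : (∑ a ∈ A, (B.filter (R a)).card) * n.factorial =
      B.card * ∑ a ∈ A, ((univ : Finset (Equiv.Perm (Fin n))).filter (R a)).card := by
    rw [Finset.sum_mul, Finset.mul_sum]
    exact Finset.sum_congr rfl fun a _ => step1 a
  have fin : ((A ×ˢ B).filter (fun ab => R ab.1 ab.2)).card * (n.factorial * n.factorial) =
    (A.card * B.card) * ((univ : Finset (Equiv.Perm (Fin n) × Equiv.Perm (Fin n))).filter
      (fun ab => R ab.1 ab.2)).card := by
    rw [e1, e2, ← mul_assoc, s1, mul_assoc, step2]; ring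
  convert fin

/-- The glued permutation. -/
noncomputable def gluePerm {n : ℕ} (e : Fin (2 * n) ≃ Fin n ⊕ Fin n)
    (g : {S : Finset (Fin (2 * n)) // S.card = n} → Fin n ⊕ Fin n ≃ Fin (2 * n))
    (x : {S : Finset (Fin (2 * n)) // S.card = n} ×
      (Equiv.Perm (Fin n) × Equiv.Perm (Fin n))) : Equiv.Perm (Fin (2 * n)) :=
  e.trans ((Equiv.sumCongr x.2.2 (x.2.1 * x.2.2)).trans (g x.1))

lemma gluePerm_injective {n : ℕ} (e : Fin (2 * n) ≃ Fin n ⊕ Fin n)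
    (g : {S : Finset (Fin (2 * n)) // S.card = n} → Fin n ⊕ Fin n ≃ Fin (2 * n))
    (hg : ∀ S z, g S z ∈ S.1 ↔ z.isLeft = true) :
    Function.Injective (gluePerm e g) := by
  rintro ⟨S, a, b⟩ ⟨S', a', b'⟩ h
  have hz : ∀ z, g S (Equiv.sumCongr b (a * b) z) = g S' (Equiv.sumCongr b' (a' * b') z) := by
    intro z
    have := DFunLike.congr_fun h (e.symm z)
    simpa [gluePerm] using this
  have hS : S = S' := by
    apply Subtype.ext
    ext y
    obtain ⟨z, rfl⟩ := ((Equiv.sumCongr b (a * b)).trans (g S)).surjective y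
    have h1 : ((Equiv.sumCongr b (a * b)).trans (g S)) z
      = g S (Equiv.sumCongr b (a * b) z) := rfl
    rw [h1, hg, hz, hg]
    cases z <;> simp
  subst hS
  have hz' : ∀ z, Equiv.sumCongr b (a * b) z = Equiv.sumCongr b' (a' * b') z :=
    fun z => (g S).injective (hz z)
  have hb : b = b' := by
    ext x
    have := hz' (Sum.inl x)
    simp at this
    rw [this]
  subst hb
  have ha : a * b = a' * b := by
    ext x
    have := hz' (Sum.inr x)
    simp at this
    simp [this]
  rw [mul_right_cancel ha]

open Finset in
theorem per_recursion (n t : ℕ) (hn : 1 ≤ n) (ht : 2 * t + 1 ≤ n)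
    (A B : Finset (Equiv.Perm (Fin n)))
    (hA : IsTwiseUniform n t A) (hB : IsTwiseUniform n (2 * t + 1) B) :
    ∃ M : Finset (Equiv.Perm (Fin (2 * n))),
      IsTwiseUniform (2 * n) (2 * t + 1) M ∧
      M.card ≤ Nat.choose (2 * n) n * A.card * B.card := by
  classical
  let e : Fin (2 * n) ≃ Fin n ⊕ Fin n := (finCongr (two_mul n)).trans finSumFinEquiv.symm
  have hc : ∀ S : {S : Finset (Fin (2 * n)) // S.card = n}, (S.1ᶜ).card = n := by
    intro S
    rw [Finset.card_compl, S.2, Fintype.card_fin]; omega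
  let g : {S : Finset (Fin (2 * n)) // S.card = n} → Fin n ⊕ Fin n ≃ Fin (2 * n) :=
    fun S => finSumEquivOfFinset S.2 (hc S)
  have hg : ∀ S z, g S z ∈ S.1 ↔ z.isLeft = true := by
    intro S z
    rcases z with x | x
    · simp [g]
    · have : g S (Sum.inr x) ∈ S.1ᶜ := by simp only [g, finSumEquivOfFinset_inr]; simp
      rw [Finset.mem_compl] at this
      simp [this]
  have hinj := gluePerm_injective e g hg
  have hcard : Fintype.card {S : Finset (Fin (2 * n)) // S.card = n} = Nat.choose (2 * n) n := by
    rw [Fintype.card_finset_len, Fintype.card_fin]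
  have hfact : Nat.choose (2 * n) n * (n.factorial * n.factorial) = (2 * n).factorial := by
    have := Nat.choose_mul_factorial_mul_factorial (n := 2 * n) (k := n) (by omega)
    rw [← this, show 2 * n - n = n by omega]; ring
  have hbij : Function.Bijective (gluePerm e g) := by
    rw [Fintype.bijective_iff_injective_and_card]
    refine ⟨hinj, ?_⟩
    rw [Fintype.card_prod, Fintype.card_prod, hcard, Fintype.card_perm, Fintype.card_perm,
      Fintype.card_fin, Fintype.card_fin, hfact]
  have hM : (((univ ×ˢ (A ×ˢ B)).image (gluePerm e g))).card =
      Nat.choose (2 * n) n * (A.card * B.card) := by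
    rw [Finset.card_image_of_injective _ hinj, card_product, card_product, card_univ, hcard]
  have hcount : ∀ (U : Finset (Equiv.Perm (Fin n) × Equiv.Perm (Fin n)))
      (i j : Fin (2 * t + 1) → Fin (2 * n)),
      (((univ ×ˢ U).image (gluePerm e g)).filter (fun σ => ∀ m, σ (i m) = j m)).card =
      ∑ S, (U.filter (fun ab => ∀ m, Equiv.sumCongr ab.2 (ab.1 * ab.2) (e (i m))
        = (g S).symm (j m))).card := by
    intro U i j
    rw [Finset.filter_image, Finset.card_image_of_injective _ hinj]
    simp only [Finset.card_filter]
    rw [Finset.sum_product]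
    refine Finset.sum_congr rfl fun S _ => Finset.sum_congr rfl fun ab _ => ?_
    refine if_congr ?_ rfl rfl
    refine forall_congr' fun m => ?_
    rw [Equiv.eq_symm_apply]
    rfl
  have huniv : ((univ ×ˢ (univ : Finset (Equiv.Perm (Fin n) × Equiv.Perm (Fin n)))).image
      (gluePerm e g)) = univ := by
    rw [Finset.univ_product_univ]
    exact Finset.image_univ_of_surjective hbij.surjective
  refine ⟨(univ ×ˢ (A ×ˢ B)).image (gluePerm e g), ⟨?_, ?_⟩, ?_⟩
  · rw [← Finset.card_pos, hM]
    have := hA.1.card_pos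
    have := hB.1.card_pos
    have := Nat.choose_pos (n := 2 * n) (k := n) (by omega)
    positivity
  · intro i j hi hj
    have h1 := hcount (A ×ˢ B) i j
    have h2 := hcount univ i j
    rw [huniv] at h2
    have h3 := univ_uniform i j hi hj
    have h4 : (((univ ×ˢ (A ×ˢ B)).image (gluePerm e g)).filter
        (fun σ => ∀ m, σ (i m) = j m)).card * (n.factorial * n.factorial) =
        (A.card * B.card) * ((univ : Finset (Equiv.Perm (Fin (2 * n)))).filter
        (fun σ => ∀ m, σ (i m) = j m)).card := by
      rw [h1, h2, Finset.sum_mul, Finset.mul_sum]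
      refine Finset.sum_congr rfl fun S _ => ?_
      exact pair_density ht hA hB (fun m => e (i m)) (fun m => (g S).symm (j m))
    have hpos : 0 < n.factorial * n.factorial := by positivity
    apply Nat.eq_of_mul_eq_mul_right hpos
    rw [hM, mul_right_comm, h4, mul_assoc, h3, ← hfact]
    ring
  · rw [hM, mul_assoc]
end

section
/- Let n ≥ 1 and t ≥ 0 be integers with 2t+1 ≤ n. If there exists a t-wise uniform set A of permutations of {1,…,n}, a (2t+1)-wise uniform set B of permutations of {1,…,n}, and a (2n,2t+1)-selection 𝒮, then there exists a (2t+1)-wise uniform set of permutations of {1,…,2n} of cardinality at most |𝒮| · |A| · |B|. -/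
/-- Uniformity for tuples indexed by arbitrary finite types of size at most `t`. -/
def GenUnif (n t : ℕ) (A : Finset (Equiv.Perm (Fin n))) : Prop :=
  ∀ (ι : Type) [Fintype ι], Fintype.card ι ≤ t → ∀ u v : ι → Fin n,
    Function.Injective u → Function.Injective v →
    (A.filter (fun σ => ∀ m, σ (u m) = v m)).card * Nat.descFactorial n (Fintype.card ι) = A.card

theorem unif_pred (n t : ℕ) (ht : t < n) (A : Finset (Equiv.Perm (Fin n)))
    (h : IsTwiseUniform n (t + 1) A) : IsTwiseUniform n t A := by
  classical
  refine ⟨h.1, fun i j hi hj => ?_⟩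
  obtain ⟨p, hp⟩ : ∃ p, p ∉ Finset.univ.image i := by
    by_contra! hc
    have h1 : (Finset.univ.image i) = Finset.univ := Finset.eq_univ_iff_forall.2 hc
    have h2 := Finset.card_image_of_injective Finset.univ hi
    rw [h1] at h2
    simp at h2
    omega
  have hp' : ∀ m, i m ≠ p := by simpa using hp
  set R := (Finset.univ.image j)ᶜ with hR
  have hRc : R.card = n - t := by
    rw [hR, Finset.card_compl, Finset.card_image_of_injective _ hj]; simp
  have key : ∀ q ∈ R, ((A.filter (fun σ => ∀ m, σ (i m) = j m)).filter
      (fun σ => σ p = q)).card * Nat.descFactorial n (t + 1) = A.card := by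
    intro q hq
    have hq' : ∀ m, j m ≠ q := by simpa [hR] using hq
    rw [← h.2 (Fin.cons p i) (Fin.cons q j)
      (Fin.cons_injective_iff.2 ⟨by simpa using hp', hi⟩)
      (Fin.cons_injective_iff.2 ⟨by simpa using hq', hj⟩), Finset.filter_filter]
    congr 2
    ext σ
    simp [Fin.forall_fin_succ, and_comm]
  have hsum := Finset.card_eq_sum_card_fiberwise
    (s := A.filter (fun σ => ∀ m, σ (i m) = j m)) (t := R) (f := fun σ => σ p) (by
      intro σ hσ
      have hσ' := (Finset.mem_filter.1 hσ).2
      simp only [hR, Finset.coe_compl, Set.mem_compl_iff, Finset.mem_coe, Finset.mem_image,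
        Finset.mem_univ, true_and, not_exists]
      intro m hm
      rw [← hσ' m] at hm
      exact hp' m (σ.injective hm))
  have h3 : (A.filter (fun σ => ∀ m, σ (i m) = j m)).card * Nat.descFactorial n (t + 1)
      = (n - t) * A.card := by
    rw [hsum, Finset.sum_mul, Finset.sum_congr rfl key]; simp [hRc]
  rw [Nat.descFactorial_succ] at h3
  have : 0 < n - t := by omega
  apply Nat.eq_of_mul_eq_mul_left this
  rw [← h3]; ring

theorem unif_mono (n t : ℕ) (ht : t ≤ n) (A : Finset (Equiv.Perm (Fin n)))
    (h : IsTwiseUniform n t A) (s : ℕ) (hs : s ≤ t) : IsTwiseUniform n s A := by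
  induction t, hs using Nat.le_induction with
  | base => exact h
  | succ t hst ih => exact ih (by omega) (unif_pred n t (by omega) A h)

theorem genUnif_of (n t : ℕ) (ht : t ≤ n) (A : Finset (Equiv.Perm (Fin n)))
    (h : IsTwiseUniform n t A) : GenUnif n t A := by
  intro ι _ hc u v hu hv
  have h1 := (unif_mono n t ht A h _ hc).2 (u ∘ (Fintype.equivFin ι).symm)
    (v ∘ (Fintype.equivFin ι).symm) (hu.comp (Equiv.injective _)) (hv.comp (Equiv.injective _))
  rw [← h1]
  congr 2
  ext σ
  simp only [Finset.mem_filter, Function.comp]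
  refine and_congr_right fun _ => ⟨fun h m => h _, fun h m => ?_⟩
  simpa using h (Fintype.equivFin ι m)

theorem exists_perm_ext {ι : Type} [Fintype ι] {n : ℕ} (u v : ι → Fin n)
    (hu : Function.Injective u) (hv : Function.Injective v) :
    ∃ π : Equiv.Perm (Fin n), ∀ m, π (u m) = v m := by
  classical
  let e : {x // x ∈ Set.range u} ≃ {x // x ∈ Set.range v} :=
    (Equiv.ofInjective u hu).symm.trans (Equiv.ofInjective v hv)
  refine ⟨e.extendSubtype, fun m => ?_⟩
  rw [Equiv.extendSubtype_apply_of_mem e (u m) ⟨m, rfl⟩]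
  have : (Equiv.ofInjective u hu).symm ⟨u m, ⟨m, rfl⟩⟩ = m := by
    rw [Equiv.symm_apply_eq]; rfl
  simp [e, this]

/-- Sum over `A` of a function of `a ∘ y`. -/
theorem sum_comp {ι : Type} [Fintype ι] {n : ℕ} (A : Finset (Equiv.Perm (Fin n)))
    (y : ι → Fin n) (hy : Function.Injective y) (c : ℕ)
    (hA : ∀ v : ι → Fin n, Function.Injective v →
      (A.filter (fun σ => ∀ m, σ (y m) = v m)).card * c = A.card)
    (f : Equiv.Perm (Fin n) → ℕ) (g : (ι ↪ Fin n) → ℕ)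
    (hfg : ∀ a (w : ι ↪ Fin n), (∀ m, a (y m) = w m) → f a = g w) :
    (∑ a ∈ A, f a) * c = A.card * ∑ w, g w := by
  classical
  have h1 := Finset.sum_fiberwise A
    (fun a => (⟨fun m => a (y m), fun p q h => hy (a.injective h)⟩ : ι ↪ Fin n)) f
  rw [← h1, Finset.sum_mul, Finset.mul_sum]
  refine Finset.sum_congr rfl fun w _ => ?_
  have h2 : ∀ a : Equiv.Perm (Fin n), ((⟨fun m => a (y m), fun p q h => hy (a.injective h)⟩ : ι ↪ Fin n) = w) ↔
      ∀ m, a (y m) = w m := by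
    intro a
    rw [DFunLike.ext_iff]; rfl
  simp only [h2]
  rw [Finset.sum_congr rfl (g := fun _ => g w)
    (fun a ha => hfg a w (Finset.mem_filter.1 ha).2), Finset.sum_const, smul_eq_mul,
    ← hA w w.injective]
  ring

theorem genUnif_univ (n : ℕ) : GenUnif n n Finset.univ := by
  classical
  intro ι _ hc u v hu hv
  have hind : ∀ w : ι ↪ Fin n,
      ((Finset.univ : Finset (Equiv.Perm (Fin n))).filter (fun σ => ∀ m, σ (u m) = w m)).card =
      ((Finset.univ : Finset (Equiv.Perm (Fin n))).filter (fun σ => ∀ m, σ (u m) = v m)).card := by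
    intro w
    obtain ⟨π, hπ⟩ := exists_perm_ext w v w.injective hv
    refine Finset.card_bij (fun σ _ => π * σ) ?_ ?_ ?_
    · intro σ hσ
      simp only [Finset.mem_filter, Finset.mem_univ, true_and] at hσ ⊢
      intro m
      simp [hσ m, hπ]
    · intro σ _ τ _ h
      exact mul_left_cancel h
    · intro σ hσ
      simp only [Finset.mem_filter, Finset.mem_univ, true_and] at hσ
      refine ⟨π⁻¹ * σ, ?_, by simp⟩
      simp only [Finset.mem_filter, Finset.mem_univ, true_and]
      intro m
      simp [hσ m, ← hπ]
  have h1 := Finset.card_eq_sum_card_fiberwise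
    (s := (Finset.univ : Finset (Equiv.Perm (Fin n)))) (t := Finset.univ)
    (f := fun a => (⟨fun m => a (u m), fun p q h => hu (a.injective h)⟩ : ι ↪ Fin n))
    (by intro _ _; simp)
  have h2 : ∀ (a : Equiv.Perm (Fin n)) (w : ι ↪ Fin n),
      ((⟨fun m => a (u m), fun p q h => hu (a.injective h)⟩ : ι ↪ Fin n) = w) ↔
      ∀ m, a (u m) = w m := by
    intro a w
    rw [DFunLike.ext_iff]; rfl
  simp only [h2] at h1
  rw [h1, Finset.sum_congr rfl (fun w _ => hind w)]
  simp [Fintype.card_embedding_eq, mul_comm]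

/-- Counting pairs, when `A` controls the second half. -/
theorem pairs_easy {ι κ : Type} [Fintype ι] [Fintype κ] {n s s' : ℕ}
    (A B : Finset (Equiv.Perm (Fin n))) (hA : GenUnif n s A) (hB : GenUnif n s' B)
    (hk : Fintype.card κ ≤ s) (hi : Fintype.card ι ≤ s')
    (x y : ι → Fin n) (x' y' : κ → Fin n) (hx : Function.Injective x) (hy : Function.Injective y)
    (hx' : Function.Injective x') (hy' : Function.Injective y') :
    (∑ a ∈ A, (B.filter (fun b => (∀ m, b (x m) = y m) ∧ ∀ l, a (b (x' l)) = y' l)).card) *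
      (n.descFactorial (Fintype.card ι) * n.descFactorial (Fintype.card κ)) = A.card * B.card := by
  classical
  have h1 : (∑ a ∈ A, (B.filter (fun b => (∀ m, b (x m) = y m) ∧ ∀ l, a (b (x' l)) = y' l)).card)
      = ∑ b ∈ B.filter (fun b => ∀ m, b (x m) = y m),
          (A.filter (fun a => ∀ l, a (b (x' l)) = y' l)).card := by
    simp only [Finset.card_filter, Finset.sum_filter]
    rw [Finset.sum_comm]
    refine Finset.sum_congr rfl fun b _ => ?_
    split_ifs with h
    · simp [h]
    · simp [h]
  rw [h1, mul_comm (n.descFactorial _), ← mul_assoc, Finset.sum_mul,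
    Finset.sum_congr rfl (fun b _ => hA κ hk (fun l => b (x' l)) y' (b.injective.comp hx') hy'),
    Finset.sum_const, smul_eq_mul, ← hB ι hi x y hx hy]
  ring

/-- Counting pairs. -/
theorem pairs_count {ι κ : Type} [Fintype ι] [Fintype κ] {n t : ℕ} (ht : 2 * t + 1 ≤ n)
    (A B : Finset (Equiv.Perm (Fin n))) (hA : GenUnif n t A) (hB : GenUnif n (2 * t + 1) B)
    (hc : Fintype.card ι + Fintype.card κ = 2 * t + 1)
    (x y : ι → Fin n) (x' y' : κ → Fin n) (hx : Function.Injective x) (hy : Function.Injective y)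
    (hx' : Function.Injective x') (hy' : Function.Injective y') :
    (∑ a ∈ A, (B.filter (fun b => (∀ m, b (x m) = y m) ∧ ∀ l, a (b (x' l)) = y' l)).card) *
      (n.descFactorial (Fintype.card ι) * n.descFactorial (Fintype.card κ)) = A.card * B.card := by
  classical
  by_cases hk : Fintype.card κ ≤ t
  · exact pairs_easy A B hA hB hk (by omega) x y x' y' hx hy hx' hy'
  have hi : Fintype.card ι ≤ t := by omega
  set D : Finset (Fin n) := Finset.univ.image x ∪ Finset.univ.image x' with hD
  have hDc : D.card ≤ 2 * t + 1 := by
    refine (Finset.card_union_le _ _).trans ?_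
    rw [Finset.card_image_of_injective _ hx, Finset.card_image_of_injective _ hx']
    simp [hc]
  set c := B.card / n.descFactorial D.card with hcdef
  let g : (ι ↪ Fin n) → ℕ := fun w =>
    if ∃ a π : Equiv.Perm (Fin n), (∀ m, a (y m) = w m) ∧ (∀ m, π (x m) = y m) ∧
      ∀ l, a (π (x' l)) = y' l then c else 0
  let f : Equiv.Perm (Fin n) → ℕ := fun a =>
    (B.filter (fun b => (∀ m, b (x m) = y m) ∧ ∀ l, a (b (x' l)) = y' l)).card
  have hfg : ∀ a (w : ι ↪ Fin n), (∀ m, a (y m) = w m) → f a = g w := by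
    intro a w haw
    simp only [f, g]
    split_ifs with h
    · obtain ⟨a₀, π₀, h1, h2, h3⟩ := h
      set π := a⁻¹ * a₀ * π₀ with hπ
      have hπx : ∀ m, π (x m) = y m := by
        intro m
        simp [hπ, h2, h1, ← haw]
      have hπx' : ∀ l, a (π (x' l)) = y' l := by
        intro l
        simp [hπ, h3]
      have hu := hB {d // d ∈ D} (by simpa using hDc) (fun d => d.1) (fun d => π d.1)
        Subtype.val_injective (π.injective.comp Subtype.val_injective)
      rw [Fintype.card_coe] at hu
      have hpos : 0 < n.descFactorial D.card :=
        Nat.descFactorial_pos.2 (by omega)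
      rw [hcdef, ← hu, Nat.mul_div_cancel _ hpos]
      congr 1
      ext b
      simp only [Finset.mem_filter]
      refine and_congr_right fun _ => ⟨?_, ?_⟩
      · rintro ⟨hb1, hb2⟩ ⟨d, hd⟩
        simp only [hD, Finset.mem_union, Finset.mem_image, Finset.mem_univ, true_and] at hd
        rcases hd with ⟨m, rfl⟩ | ⟨l, rfl⟩
        · simp [hb1, hπx]
        · exact a.injective (by simp [hb2, hπx'])
      · intro hb
        refine ⟨fun m => ?_, fun l => ?_⟩
        · rw [← hπx m]; exact hb ⟨x m, by simp [hD]⟩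
        · rw [← hπx' l]; exact congrArg a (hb ⟨x' l, by simp [hD]⟩)
    · rw [Finset.card_eq_zero, Finset.filter_eq_empty_iff]
      rintro b _ ⟨hb1, hb2⟩
      exact h ⟨a, b, haw, hb1, hb2⟩
  have hS1 := sum_comp A y hy _ (fun v hv => hA ι hi y v hy hv) f g hfg
  have hS2 := sum_comp Finset.univ y hy _
    (fun v hv => genUnif_univ n ι (by omega) y v hy hv) f g hfg
  have hE := pairs_easy Finset.univ B (genUnif_univ n) hB (κ := κ) (ι := ι) (by omega) (by omega)
    x y x' y' hx hy hx' hy'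
  change (∑ a, f a) * _ = _ at hE
  change (∑ a ∈ A, f a) * _ = _
  rw [← mul_assoc, hS2, mul_assoc] at hE
  have hpos : 0 < (Finset.univ : Finset (Equiv.Perm (Fin n))).card :=
    Finset.card_pos.2 Finset.univ_nonempty
  have hE' := Nat.eq_of_mul_eq_mul_left hpos hE
  rw [← mul_assoc, hS1, mul_assoc, hE']

theorem binom_identity (n k k' T : ℕ) (hT : k + k' = T) (hTn : T ≤ n) :
    Nat.choose (2 * n) n * (n.descFactorial k * n.descFactorial k') =
      Nat.choose (2 * n - T) (n - k) * (2 * n).descFactorial T := by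
  have h1 := Nat.choose_mul_factorial_mul_factorial (n := 2 * n) (k := n) (by omega)
  have h2 := Nat.choose_mul_factorial_mul_factorial (n := 2 * n - T) (k := n - k) (by omega)
  have h3 := Nat.factorial_mul_descFactorial (n := n) (k := k) (by omega)
  have h4 := Nat.factorial_mul_descFactorial (n := n) (k := k') (by omega)
  have h5 := Nat.factorial_mul_descFactorial (n := 2 * n) (k := T) (by omega)
  rw [show 2 * n - n = n by omega] at h1
  rw [show 2 * n - T - (n - k) = n - k' by omega] at h2
  have hpos : 0 < (n - k).factorial * (n - k').factorial := by positivity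
  apply Nat.eq_of_mul_eq_mul_left hpos
  calc _ = Nat.choose (2 * n) n * ((n - k).factorial * n.descFactorial k) *
        ((n - k').factorial * n.descFactorial k') := by ring
    _ = (2 * n).factorial := by rw [h3, h4, h1]
    _ = _ := by rw [← h5, ← h2]; ring

/-- Counting pairs for a fixed selected set, in terms of sums. -/
theorem sum_side_count {n t : ℕ} (ht : 2 * t + 1 ≤ n)
    (A B : Finset (Equiv.Perm (Fin n))) (hA : GenUnif n t A) (hB : GenUnif n (2 * t + 1) B)
    (p q : Fin (2 * t + 1) → Fin n ⊕ Fin n) (hp : Function.Injective p)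
    (hq : Function.Injective q) (hpq : ∀ m, (p m).isLeft = (q m).isLeft) (k : ℕ)
    (hk : k = (Finset.univ.filter (fun m => (p m).isLeft = true)).card) :
    ((A ×ˢ B).filter (fun ab => ∀ m, Equiv.sumCongr ab.2 (ab.2.trans ab.1) (p m) = q m)).card *
      (n.descFactorial k * n.descFactorial (2 * t + 1 - k)) = A.card * B.card := by
  classical
  let ι := {m // (p m).isLeft = true}
  let κ := {m // ¬ (p m).isLeft = true}
  have hcι : Fintype.card ι = k := by
    rw [hk, Fintype.card_subtype]
  have hck : Fintype.card ι + Fintype.card κ = 2 * t + 1 := by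
    have := Fintype.card_subtype_compl (fun m => (p m).isLeft = true)
    have h2 := Fintype.card_subtype_le (fun m => (p m).isLeft = true)
    simp only [Fintype.card_fin] at this h2
    simp only [ι, κ]
    omega
  have hcκ : Fintype.card κ = 2 * t + 1 - k := by omega
  have hxe : ∀ m : ι, ∃ z, p m.1 = Sum.inl z := fun m => Sum.isLeft_iff.1 m.2
  have hye : ∀ m : ι, ∃ z, q m.1 = Sum.inl z := fun m => Sum.isLeft_iff.1 (hpq m.1 ▸ m.2)
  have hxe' : ∀ m : κ, ∃ z, p m.1 = Sum.inr z := fun m => by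
    have := m.2
    rw [← Sum.isRight_iff]; simpa using this
  have hye' : ∀ m : κ, ∃ z, q m.1 = Sum.inr z := fun m => by
    have := m.2
    rw [hpq] at this
    rw [← Sum.isRight_iff]; simpa using this
  choose x hx using hxe
  choose y hy using hye
  choose x' hx' using hxe'
  choose y' hy' using hye'
  have inj : ∀ {ν : Fin (2 * t + 1) → Prop} (r : Fin (2 * t + 1) → Fin n ⊕ Fin n)
      (hr : Function.Injective r) (F : Fin n → Fin n ⊕ Fin n)
      (z : {m // ν m} → Fin n) (hz : ∀ m, r m.1 = F (z m)), Function.Injective z := by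
    intro ν r hr F z hz m m' h
    apply Subtype.ext
    apply hr
    rw [hz, hz, h]
  have main := pairs_count ht A B hA hB hck x y x' y' (inj p hp _ x hx) (inj q hq _ y hy)
    (inj p hp _ x' hx') (inj q hq _ y' hy')
  rw [hcι, hcκ] at main
  rw [← main]
  congr 1
  rw [Finset.card_filter, Finset.sum_product]
  refine Finset.sum_congr rfl fun a _ => ?_
  rw [Finset.card_filter]
  refine Finset.sum_congr rfl fun b _ => ?_
  refine if_congr ⟨fun h => ⟨fun m => ?_, fun m => ?_⟩, fun h m => ?_⟩ rfl rfl
  · have := h m.1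
    rw [hx, hy] at this
    simpa using this
  · have := h m.1
    rw [hx', hy'] at this
    simpa using this
  · by_cases hm : (p m).isLeft = true
    · have h1 := hx ⟨m, hm⟩
      have h2 := hy ⟨m, hm⟩
      simp only at h1 h2
      rw [h1, h2]
      simpa using h.1 ⟨m, hm⟩
    · have h1 := hx' ⟨m, hm⟩
      have h2 := hy' ⟨m, hm⟩
      simp only at h1 h2
      rw [h1, h2]
      simpa using h.2 ⟨m, hm⟩

theorem exists_split (n : ℕ) (S : Finset (Fin (2 * n))) (hS : S.card = n) :
    ∃ E : Fin n ⊕ Fin n ≃ Fin (2 * n), ∀ z, E z ∈ S ↔ z.isLeft = true := by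
  have hS' : (Sᶜ).card = n := by
    rw [Finset.card_compl, hS]; simp; omega
  refine ⟨finSumEquivOfFinset hS hS', ?_⟩
  rintro (z | z)
  · simp
  · have := Finset.orderEmbOfFin_mem Sᶜ hS' z
    rw [Finset.mem_compl] at this
    simpa using this

/-- The recursion `per(2n, 2t+1) ≤ sel(2n,2t+1)·per(n,2t+1)·per(n,t)`: from a `t`-wise uniform
set `A`, a `(2t+1)`-wise uniform set `B` on `n` elements, and a `(2n,2t+1)`-selection `𝒮`,
one obtains a `(2t+1)`-wise uniform set on `2n` elements of size at most `|𝒮|·|A|·|B|`. -/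
theorem per_recursion_selection (n t : ℕ) (hn : 1 ≤ n) (ht : 2 * t + 1 ≤ n)
    (A B : Finset (Equiv.Perm (Fin n)))
    (hA : IsTwiseUniform n t A) (hB : IsTwiseUniform n (2 * t + 1) B)
    (𝒮 : Finset (Finset (Fin (2 * n)))) (h𝒮 : IsSelection n (2 * t + 1) 𝒮) :
    ∃ M : Finset (Equiv.Perm (Fin (2 * n))),
      IsTwiseUniform (2 * n) (2 * t + 1) M ∧
      M.card ≤ 𝒮.card * A.card * B.card := by
  classical
  have gA := genUnif_of n t (by omega) A hA
  have gB := genUnif_of n (2 * t + 1) ht B hB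
  obtain ⟨hne, hcard, hsel⟩ := h𝒮
  have hEx : ∀ S : Finset (Fin (2 * n)), ∃ E : Fin n ⊕ Fin n ≃ Fin (2 * n),
      S ∈ 𝒮 → ∀ z, E z ∈ S ↔ z.isLeft = true := by
    intro S
    by_cases hS : S ∈ 𝒮
    · obtain ⟨E, hE⟩ := exists_split n S (hcard S hS)
      exact ⟨E, fun _ => hE⟩
    · exact ⟨finSumFinEquiv.trans (finCongr (by omega)), fun h => absurd h hS⟩
  choose E hE using hEx
  let e : Fin n ⊕ Fin n ≃ Fin (2 * n) := finSumFinEquiv.trans (finCongr (by omega))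
  let Φ : Finset (Fin (2 * n)) × (Equiv.Perm (Fin n) × Equiv.Perm (Fin n)) →
      Equiv.Perm (Fin (2 * n)) := fun w =>
    e.symm.trans ((Equiv.sumCongr w.2.2 (w.2.2.trans w.2.1)).trans (E w.1))
  have hinj : Set.InjOn Φ ((𝒮 ×ˢ (A ×ˢ B) : Finset _) : Set _) := by
    rintro ⟨S, a, b⟩ h1 ⟨S', a', b'⟩ h2 heq
    simp only [Finset.coe_product, Set.mem_prod, Finset.mem_coe] at h1 h2
    have hpt : ∀ z, E S (Equiv.sumCongr b (b.trans a) z) =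
        E S' (Equiv.sumCongr b' (b'.trans a') z) := by
      intro z
      have := congrArg (fun σ => σ (e z)) heq
      simpa [Φ] using this
    have hSS : S = S' := by
      ext v
      obtain ⟨z, rfl⟩ : ∃ z, E S (Equiv.sumCongr b (b.trans a) z) = v :=
        ⟨(Equiv.sumCongr b (b.trans a)).symm ((E S).symm v), by
          rw [Equiv.apply_symm_apply, Equiv.apply_symm_apply]⟩
      rw [hE S h1.1, hpt z, hE S' h2.1]
      cases z <;> simp
    subst hSS
    have hb : b = b' := by
      ext z
      have := (E S).injective (hpt (Sum.inl z))
      simp at this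
      rw [this]
    subst hb
    have ha : a = a' := by
      ext z
      have := (E S).injective (hpt (Sum.inr (b.symm z)))
      simp at this
      rw [this]
    subst ha
    rfl
  have hMc : ((𝒮 ×ˢ (A ×ˢ B)).image Φ).card = 𝒮.card * (A.card * B.card) := by
    rw [Finset.card_image_of_injOn hinj, Finset.card_product, Finset.card_product]
  refine ⟨(𝒮 ×ˢ (A ×ˢ B)).image Φ, ⟨?_, ?_⟩, ?_⟩
  · exact (hne.product (hA.1.product hB.1)).image _
  · intro i j hi hj
    rw [hMc, Finset.filter_image, Finset.card_image_of_injOn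
      (hinj.mono (by intro w hw; exact (Finset.mem_filter.1 hw).1))]
    set p : Fin (2 * t + 1) → Fin n ⊕ Fin n := fun m => e.symm (i m) with hpdef
    set L := Finset.univ.filter (fun m => (p m).isLeft = true) with hL
    have hkT : L.card ≤ 2 * t + 1 := by simpa using Finset.card_le_univ L
    set I := Finset.univ.image j with hI
    set J := L.image j with hJ
    have hIc : I.card = 2 * t + 1 := by
      rw [hI, Finset.card_image_of_injective _ hj]; simp
    have hJc : J.card = L.card := Finset.card_image_of_injective _ hj
    have hs := hsel I J hIc (Finset.image_subset_image (Finset.subset_univ _))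
    rw [hJc] at hs
    have hmatch : ∀ S, (J ⊆ S ∧ Disjoint (I \ J) S) ↔ ∀ m, (j m ∈ S ↔ (p m).isLeft = true) := by
      intro S
      have hjJ : ∀ m, j m ∈ J ↔ (p m).isLeft = true := by
        intro m
        rw [hJ, Finset.mem_image]
        constructor
        · rintro ⟨m', hm', h⟩
          rw [hj h] at hm'
          exact (Finset.mem_filter.1 hm').2
        · intro h
          exact ⟨m, by simp [hL, h], rfl⟩
      constructor
      · rintro ⟨h1, h2⟩ m
        rw [← hjJ]
        refine ⟨fun h => ?_, fun h => h1 h⟩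
        by_contra hc
        exact Finset.disjoint_left.1 h2 (Finset.mem_sdiff.2 ⟨by simp [hI], hc⟩) h
      · intro h
        refine ⟨?_, ?_⟩
        · intro v hv
          obtain ⟨m, _, rfl⟩ := Finset.mem_image.1 hv
          exact (h m).2 ((hjJ m).1 hv)
        · rw [Finset.disjoint_left]
          intro v hv
          obtain ⟨hv1, hv2⟩ := Finset.mem_sdiff.1 hv
          obtain ⟨m, _, rfl⟩ := Finset.mem_image.1 hv1
          rw [h m, ← hjJ]
          exact hv2
    have hcount : ((𝒮 ×ˢ (A ×ˢ B)).filter (fun w => ∀ m, Φ w (i m) = j m)).card *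
        (n.descFactorial L.card * n.descFactorial (2 * t + 1 - L.card)) =
        (𝒮.filter (fun S => J ⊆ S ∧ Disjoint (I \ J) S)).card * (A.card * B.card) := by
      rw [Finset.card_filter, Finset.sum_product, Finset.sum_mul,
        Finset.card_filter (fun S => J ⊆ S ∧ Disjoint (I \ J) S) 𝒮, Finset.sum_mul]
      refine Finset.sum_congr rfl fun S hS => ?_
      rw [← Finset.card_filter]
      have hΦ : ∀ ab : Equiv.Perm (Fin n) × Equiv.Perm (Fin n), ∀ m, Φ (S, ab) (i m) = j m ↔
          Equiv.sumCongr ab.2 (ab.2.trans ab.1) (p m) = (E S).symm (j m) := by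
        intro ab m
        rw [Equiv.eq_symm_apply]
        rfl
      simp only [hΦ]
      have hmem : ∀ m, j m ∈ S ↔ ((E S).symm (j m)).isLeft = true := by
        intro m
        rw [← hE S hS, Equiv.apply_symm_apply]
      split_ifs with h
      · rw [hmatch] at h
        rw [one_mul]
        convert sum_side_count ht A B gA gB p (fun m => (E S).symm (j m))
          (e.symm.injective.comp hi) ((E S).symm.injective.comp hj) ?_ L.card rfl using 3
        intro m
        rw [Bool.eq_iff_iff, ← hmem, h]
      · rw [zero_mul]
        apply mul_eq_zero_of_left
        rw [Finset.card_eq_zero, Finset.filter_eq_empty_iff]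
        intro ab _ hab
        apply h
        rw [hmatch]
        intro m
        rw [hmem, ← hab m]
        cases p m <;> simp
    have hb := binom_identity n L.card (2 * t + 1 - L.card) (2 * t + 1) (by omega) ht
    have hpos : 0 < Nat.choose (2 * n - (2 * t + 1)) (n - L.card) :=
      Nat.choose_pos (by omega)
    apply Nat.eq_of_mul_eq_mul_left hpos
    generalize ((𝒮 ×ˢ (A ×ˢ B)).filter (fun w => ∀ m, Φ w (i m) = j m)).card = N at hcount ⊢
    calc _ = N * (Nat.choose (2 * n - (2 * t + 1)) (n - L.card) *
          (2 * n).descFactorial (2 * t + 1)) := by ring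
      _ = (N * (n.descFactorial L.card * n.descFactorial (2 * t + 1 - L.card))) *
          Nat.choose (2 * n) n := by rw [← hb]; ring
      _ = ((𝒮.filter (fun S => J ⊆ S ∧ Disjoint (I \ J) S)).card * Nat.choose (2 * n) n) *
          (A.card * B.card) := by rw [hcount]; ring
      _ = _ := by rw [hs]; ring
  · rw [hMc, mul_assoc]
end

section
/- Let n ≥ 1 and t ≥ 0 be integers with t ≤ n, let A₁ and A₂ be t-wise uniform sets of permutations of {1,…,n}, and let 𝒮 be a (2n,t)-selection. For each S ∈ 𝒮 fix bijections f_S : S → {1,…,n} and g_S : S^c → {1,…,n}. Then the set of permutations ν_{S,τ₁,τ₂} of {1,…,2n}, ranging over S ∈ 𝒮, τ₁ ∈ A₁, τ₂ ∈ A₂, where ν_{S,τ₁,τ₂}(x) = τ₁(f_S(x)) for x ∈ S and ν_{S,τ₁,τ₂}(x) = τ₂(g_S(x)) + n for x ∈ S^c, is a t-wise uniform set of permutations of {1,…,2n}. In particular there exists a t-wise uniform set of permutations of {1,…,2n} of cardinality at most |𝒮| · |A₁| · |A₂|. -/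
/-- The permutation `ν_{S,τ₁,τ₂}` of `Fin (2n)`: on `S` it acts by `x ↦ τ₁(f(x))` (landing in
the first `n` values) and on `Sᶜ` by `x ↦ τ₂(g(x)) + n`. -/
def nu (n : ℕ) (S : Finset (Fin (2 * n)))
    (f : {x // x ∈ S} ≃ Fin n) (g : {x // x ∉ S} ≃ Fin n)
    (τ₁ τ₂ : Equiv.Perm (Fin n)) : Equiv.Perm (Fin (2 * n)) :=
  ((Equiv.sumCompl (· ∈ S)).symm.trans
    (Equiv.sumCongr (f.trans τ₁) (g.trans τ₂))).trans
    (finSumFinEquiv.trans (finCongr (two_mul n).symm))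

theorem IsTwiseUniform.pred {n s : ℕ} (hs : s < n) {T : Finset (Equiv.Perm (Fin n))}
    (h : IsTwiseUniform n (s + 1) T) : IsTwiseUniform n s T := by
  refine ⟨h.1, fun i j hi hj => ?_⟩
  obtain ⟨x, hx⟩ : ∃ x, x ∉ Set.range i := by
    by_contra! hc
    have h1 := Fintype.card_le_of_surjective i (fun y => hc y)
    simp at h1
    omega
  have hcard : ((Finset.univ.image j)ᶜ : Finset (Fin n)).card = n - s := by
    rw [Finset.card_compl, Finset.card_image_of_injective _ hj]
    simp
  have hsum : (T.filter (fun σ => ∀ m, σ (i m) = j m)).card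
      = ∑ y ∈ (Finset.univ.image j)ᶜ,
        ((T.filter (fun σ => ∀ m, σ (i m) = j m)).filter (fun σ => σ x = y)).card := by
    apply Finset.card_eq_sum_card_fiberwise
    intro σ hσ
    simp only [Finset.coe_filter, Set.mem_ofPred_eq] at hσ
    simp only [Finset.coe_compl, Set.mem_compl_iff, Finset.mem_coe, Finset.mem_image,
      Finset.mem_univ, true_and, not_exists]
    intro m hm
    rw [← hσ.2 m] at hm
    exact hx ⟨m, σ.injective hm⟩
  have key : (T.filter (fun σ => ∀ m, σ (i m) = j m)).card * Nat.descFactorial n (s + 1)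
      = (n - s) * T.card := by
    rw [hsum, Finset.sum_mul, ← hcard, ← smul_eq_mul, ← Finset.sum_const]
    refine Finset.sum_congr rfl fun y hy => ?_
    have hy' : y ∉ Set.range j := by
      simpa using hy
    rw [← h.2 (Fin.cons x i) (Fin.cons y j) (Fin.cons_injective_iff.2 ⟨hx, hi⟩)
      (Fin.cons_injective_iff.2 ⟨hy', hj⟩), Finset.filter_filter]
    congr 2
    ext σ
    simp only [Finset.mem_filter, Fin.forall_fin_succ, Fin.cons_zero, Fin.cons_succ]
    tauto
  rw [Nat.descFactorial_succ] at key
  have hpos : 0 < n - s := by omega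
  apply Nat.eq_of_mul_eq_mul_left hpos
  rw [← key]
  ring

theorem IsTwiseUniform.mono {n t : ℕ} (ht : t ≤ n) {T : Finset (Equiv.Perm (Fin n))}
    (h : IsTwiseUniform n t T) {s : ℕ} (hs : s ≤ t) : IsTwiseUniform n s T := by
  induction t, hs using Nat.le_induction with
  | base => exact h
  | succ k hk ih => exact ih (by omega) (h.pred (by omega))

theorem IsTwiseUniform.card_type {n t : ℕ} (ht : t ≤ n) {T : Finset (Equiv.Perm (Fin n))}
    (h : IsTwiseUniform n t T) {κ : Type} [Fintype κ] (hκ : Fintype.card κ ≤ t)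
    (i j : κ → Fin n) (hi : Function.Injective i) (hj : Function.Injective j) :
    (T.filter (fun σ => ∀ m, σ (i m) = j m)).card * Nat.descFactorial n (Fintype.card κ)
      = T.card := by
  have e := (Fintype.equivFin κ).symm
  rw [← (h.mono ht hκ).2 (i ∘ e) (j ∘ e) (hi.comp e.injective) (hj.comp e.injective)]
  congr 2
  ext σ
  simp only [Finset.mem_filter, Function.comp]
  rw [e.forall_congr_left]
  simp

theorem nu_val_mem {n : ℕ} {S : Finset (Fin (2 * n))}
    (f : {x // x ∈ S} ≃ Fin n) (g : {x // x ∉ S} ≃ Fin n)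
    (τ₁ τ₂ : Equiv.Perm (Fin n)) (x : Fin (2 * n)) (hx : x ∈ S) :
    (nu n S f g τ₁ τ₂ x).val = (τ₁ (f ⟨x, hx⟩)).val := by
  simp [nu, Equiv.sumCompl_symm_apply_of_pos, hx]

theorem nu_val_notMem {n : ℕ} {S : Finset (Fin (2 * n))}
    (f : {x // x ∈ S} ≃ Fin n) (g : {x // x ∉ S} ≃ Fin n)
    (τ₁ τ₂ : Equiv.Perm (Fin n)) (x : Fin (2 * n)) (hx : x ∉ S) :
    (nu n S f g τ₁ τ₂ x).val = n + (τ₂ (g ⟨x, hx⟩)).val := by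
  simp [nu, Equiv.sumCompl_symm_apply_of_neg, hx, Nat.add_comm]

theorem nu_lt_iff {n : ℕ} {S : Finset (Fin (2 * n))}
    (f : {x // x ∈ S} ≃ Fin n) (g : {x // x ∉ S} ≃ Fin n)
    (τ₁ τ₂ : Equiv.Perm (Fin n)) (x : Fin (2 * n)) :
    (nu n S f g τ₁ τ₂ x).val < n ↔ x ∈ S := by
  by_cases hx : x ∈ S
  · rw [nu_val_mem f g τ₁ τ₂ x hx]
    simp [hx]
  · rw [nu_val_notMem f g τ₁ τ₂ x hx]
    simp [hx]

theorem nu_inj {n : ℕ} {S : Finset (Fin (2 * n))}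
    (f : {x // x ∈ S} ≃ Fin n) (g : {x // x ∉ S} ≃ Fin n)
    (τ₁ τ₂ ρ₁ ρ₂ : Equiv.Perm (Fin n)) (h : nu n S f g τ₁ τ₂ = nu n S f g ρ₁ ρ₂) :
    τ₁ = ρ₁ ∧ τ₂ = ρ₂ := by
  constructor
  · ext y
    obtain ⟨⟨x, hx⟩, rfl⟩ := f.surjective y
    rw [← nu_val_mem f g τ₁ τ₂ x hx, h, nu_val_mem f g ρ₁ ρ₂ x hx]
  · ext y
    obtain ⟨⟨x, hx⟩, rfl⟩ := g.surjective y
    have h1 := nu_val_notMem f g τ₁ τ₂ x hx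
    rw [h, nu_val_notMem f g ρ₁ ρ₂ x hx] at h1
    omega

theorem numeric_aux (n a b : ℕ) (ha : a ≤ n) (hb : b ≤ n) :
    Nat.choose (2 * n - (a + b)) (n - a) * Nat.descFactorial (2 * n) (a + b)
      = Nat.choose (2 * n) n * (Nat.descFactorial n a * Nat.descFactorial n b) := by
  have h1 := Nat.choose_mul_factorial_mul_factorial
    (show n - a ≤ 2 * n - (a + b) by omega)
  have h2 := Nat.choose_mul_factorial_mul_factorial (show n ≤ 2 * n by omega)
  have h3 := Nat.factorial_mul_descFactorial (show a + b ≤ 2 * n by omega)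
  have h4 := Nat.factorial_mul_descFactorial ha
  have h5 := Nat.factorial_mul_descFactorial hb
  rw [show 2 * n - (a + b) - (n - a) = n - b by omega] at h1
  rw [show 2 * n - n = n by omega] at h2
  have hpos : 0 < (n - a).factorial * (n - b).factorial := by positivity
  apply Nat.eq_of_mul_eq_mul_right hpos
  calc _ = (Nat.choose (2 * n - (a + b)) (n - a) * (n - a).factorial * (n - b).factorial)
        * Nat.descFactorial (2 * n) (a + b) := by ring
    _ = Nat.choose (2 * n) n * n.factorial * n.factorial := by rw [h1, h3, h2]
    _ = Nat.choose (2 * n) n * ((n - a).factorial * Nat.descFactorial n a)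
        * ((n - b).factorial * Nat.descFactorial n b) := by rw [h4, h5]
    _ = _ := by ring

/-- Count of pairs for one fixed set. -/
theorem count_fixed {n t : ℕ} (ht : t ≤ n) {A₁ A₂ : Finset (Equiv.Perm (Fin n))}
    (hA₁ : IsTwiseUniform n t A₁) (hA₂ : IsTwiseUniform n t A₂)
    (S : Finset (Fin (2 * n))) (f : {x // x ∈ S} ≃ Fin n) (g : {x // x ∉ S} ≃ Fin n)
    (i j : Fin t → Fin (2 * n)) (hi : Function.Injective i) (hj : Function.Injective j) :
    ((A₁ ×ˢ A₂).filter (fun q => ∀ m, nu n S f g q.1 q.2 (i m) = j m)).card *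
      (Nat.descFactorial n (Fintype.card {m // (j m).val < n}) *
        Nat.descFactorial n (Fintype.card {m // ¬ (j m).val < n}))
      = if (∀ m, i m ∈ S ↔ (j m).val < n) then A₁.card * A₂.card else 0 := by
  split_ifs with hgood
  · let i₁ : {m // (j m).val < n} → Fin n := fun m => f ⟨i m, (hgood m).2 m.2⟩
    let j₁ : {m // (j m).val < n} → Fin n := fun m => ⟨(j m).val, m.2⟩
    let i₂ : {m // ¬ (j m).val < n} → Fin n := fun m => g ⟨i m, fun h => m.2 ((hgood m).1 h)⟩
    let j₂ : {m // ¬ (j m).val < n} → Fin n := fun m => ⟨(j m).val - n, by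
      have := (j m).isLt
      have := m.2
      omega⟩
    have hi₁ : Function.Injective i₁ := by
      intro a b hab
      have := f.injective hab
      exact Subtype.ext (hi (congrArg Subtype.val this))
    have hi₂ : Function.Injective i₂ := by
      intro a b hab
      have := g.injective hab
      exact Subtype.ext (hi (congrArg Subtype.val this))
    have hj₁ : Function.Injective j₁ := by
      intro a b hab
      have := congrArg Fin.val hab
      exact Subtype.ext (hj (Fin.ext this))
    have hj₂ : Function.Injective j₂ := by
      intro a b hab
      have h1 : (j a).val - n = (j b).val - n := congrArg Fin.val hab
      have ha := a.2
      have hb := b.2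
      exact Subtype.ext (hj (Fin.ext (by omega)))
    have hc₁ : Fintype.card {m // (j m).val < n} ≤ t := by
      simpa using Fintype.card_subtype_le (fun m => (j m).val < n)
    have hc₂ : Fintype.card {m // ¬ (j m).val < n} ≤ t := by
      simpa using Fintype.card_subtype_le (fun m => ¬ (j m).val < n)
    have e₁ := hA₁.card_type ht hc₁ i₁ j₁ hi₁ hj₁
    have e₂ := hA₂.card_type ht hc₂ i₂ j₂ hi₂ hj₂
    have hprod : (A₁ ×ˢ A₂).filter (fun q => ∀ m, nu n S f g q.1 q.2 (i m) = j m)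
        = (A₁.filter (fun σ => ∀ m, σ (i₁ m) = j₁ m)) ×ˢ
          (A₂.filter (fun σ => ∀ m, σ (i₂ m) = j₂ m)) := by
      rw [← Finset.filter_product]
      apply Finset.filter_congr
      rintro ⟨τ₁, τ₂⟩ -
      constructor
      · intro h
        refine ⟨fun m => ?_, fun m => ?_⟩
        · apply Fin.ext
          have h1 := nu_val_mem f g τ₁ τ₂ (i m) ((hgood m).2 m.2)
          rw [h m] at h1
          exact h1.symm
        · apply Fin.ext
          have h1 := nu_val_notMem f g τ₁ τ₂ (i m) (fun h => m.2 ((hgood m).1 h))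
          rw [h m] at h1
          change (τ₂ (i₂ m)).val = (j m).val - n
          change (j m).val = n + (τ₂ (i₂ m)).val at h1
          omega
      · rintro ⟨h1, h2⟩ m
        apply Fin.ext
        by_cases hm : (j m).val < n
        · rw [nu_val_mem f g τ₁ τ₂ (i m) ((hgood m).2 hm)]
          exact congrArg Fin.val (h1 ⟨m, hm⟩)
        · rw [nu_val_notMem f g τ₁ τ₂ (i m) (fun h => hm ((hgood m).1 h))]
          have h3 : (τ₂ (i₂ ⟨m, hm⟩)).val = (j m).val - n := congrArg Fin.val (h2 ⟨m, hm⟩)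
          change n + (τ₂ (i₂ ⟨m, hm⟩)).val = _
          omega
    rw [hprod, Finset.card_product, ← e₁, ← e₂]
    ring
  · rw [Finset.filter_false_of_mem, Finset.card_empty, zero_mul]
    intro q _ h
    exact hgood fun m => by rw [← h m, nu_lt_iff]

/-- Naive divide-and-conquer: if `A₁, A₂` are `t`-wise uniform sets on `n` elements and `𝒮` is
a `(2n,t)`-selection, then `{ν_{S,τ₁,τ₂} : S ∈ 𝒮, τ₁ ∈ A₁, τ₂ ∈ A₂}` is a `t`-wise uniform
set on `2n` elements; in particular there is such a set of size at most `|𝒮|·|A₁|·|A₂|`. -/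
theorem nu_image_isTwiseUniform (n t : ℕ) (hn : 1 ≤ n) (ht : t ≤ n)
    (A₁ A₂ : Finset (Equiv.Perm (Fin n)))
    (hA₁ : IsTwiseUniform n t A₁) (hA₂ : IsTwiseUniform n t A₂)
    (𝒮 : Finset (Finset (Fin (2 * n)))) (h𝒮 : IsSelection n t 𝒮)
    (f : (S : Finset (Fin (2 * n))) → S ∈ 𝒮 → ({x // x ∈ S} ≃ Fin n))
    (g : (S : Finset (Fin (2 * n))) → S ∈ 𝒮 → ({x // x ∉ S} ≃ Fin n)) :
    IsTwiseUniform (2 * n) t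
      ((𝒮.attach ×ˢ A₁ ×ˢ A₂).image
        (fun q => nu n q.1.1 (f q.1.1 q.1.2) (g q.1.1 q.1.2) q.2.1 q.2.2)) ∧
    ((𝒮.attach ×ˢ A₁ ×ˢ A₂).image
        (fun q => nu n q.1.1 (f q.1.1 q.1.2) (g q.1.1 q.1.2) q.2.1 q.2.2)).card
      ≤ 𝒮.card * A₁.card * A₂.card := by
  classical
  have hinj : Function.Injective
      (fun q : {S // S ∈ 𝒮} × Equiv.Perm (Fin n) × Equiv.Perm (Fin n) =>
        nu n q.1.1 (f q.1.1 q.1.2) (g q.1.1 q.1.2) q.2.1 q.2.2) := by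
    rintro ⟨⟨S, hS⟩, τ₁, τ₂⟩ ⟨⟨S', hS'⟩, ρ₁, ρ₂⟩ h
    dsimp only at h
    have hSS : S = S' := by
      ext x
      rw [← nu_lt_iff (f S hS) (g S hS) τ₁ τ₂ x, h, nu_lt_iff]
    subst hSS
    obtain ⟨rfl, rfl⟩ := nu_inj _ _ _ _ _ _ h
    rfl
  have hcard : ((𝒮.attach ×ˢ A₁ ×ˢ A₂).image
        (fun q => nu n q.1.1 (f q.1.1 q.1.2) (g q.1.1 q.1.2) q.2.1 q.2.2)).card
      = 𝒮.card * A₁.card * A₂.card := by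
    rw [Finset.card_image_of_injective _ hinj, Finset.card_product, Finset.card_product,
      Finset.card_attach, mul_assoc]
  refine ⟨⟨?_, fun i j hi hj => ?_⟩, hcard.le⟩
  · exact (((Finset.attach_nonempty_iff).2 h𝒮.1).product (hA₁.1.product hA₂.1)).image _
  rw [hcard, Finset.filter_image, Finset.card_image_of_injective _ hinj]
  set a := Fintype.card {m // (j m).val < n} with ha
  set b := Fintype.card {m // ¬ (j m).val < n} with hb
  have hab : a + b = t := by
    rw [ha, hb, Fintype.card_subtype_compl, Fintype.card_fin]
    have : Fintype.card {m // (j m).val < n} ≤ t := by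
      simpa using Fintype.card_subtype_le (fun m => (j m).val < n)
    omega
  set N := ((𝒮.attach ×ˢ A₁ ×ˢ A₂).filter (fun q => ∀ m,
    nu n q.1.1 (f q.1.1 q.1.2) (g q.1.1 q.1.2) q.2.1 q.2.2 (i m) = j m)).card with hN
  have hcount : N * (n.descFactorial a * n.descFactorial b)
      = (𝒮.filter (fun S => ∀ m, i m ∈ S ↔ (j m).val < n)).card * (A₁.card * A₂.card) := by
    rw [hN, Finset.card_filter, Finset.sum_product, Finset.sum_mul, Finset.card_filter,
      Finset.sum_mul, ← Finset.sum_attach 𝒮]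
    refine Finset.sum_congr rfl fun S _ => ?_
    rw [← Finset.card_filter, ha, hb]
    rw [count_fixed ht hA₁ hA₂ S.1 (f S.1 S.2) (g S.1 S.2) i j hi hj, ite_mul, one_mul, zero_mul]
  have hsel := h𝒮.2.2 (Finset.univ.image i)
    ((Finset.univ.filter (fun m => (j m).val < n)).image i)
    (by rw [Finset.card_image_of_injective _ hi]; simp)
    (Finset.image_subset_image (Finset.filter_subset _ _))
  rw [Finset.card_image_of_injective _ hi, ← Fintype.card_subtype, ← ha] at hsel
  have hfil : 𝒮.filter (fun S => (Finset.univ.filter (fun m => (j m).val < n)).image i ⊆ S ∧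
      Disjoint (Finset.univ.image i \ (Finset.univ.filter (fun m => (j m).val < n)).image i) S)
      = 𝒮.filter (fun S => ∀ m, i m ∈ S ↔ (j m).val < n) := by
    apply Finset.filter_congr
    intro S _
    rw [← Finset.image_sdiff _ _ hi, Finset.disjoint_left, Finset.image_subset_iff]
    simp only [Finset.mem_filter, Finset.mem_univ, true_and, Finset.mem_image, Finset.mem_sdiff,
      forall_exists_index, and_imp]
    constructor
    · rintro ⟨h1, h2⟩ m
      refine ⟨fun h => ?_, h1 m⟩
      by_contra hm
      exact h2 m hm rfl h
    · intro h
      refine ⟨fun m hm => (h m).2 hm, ?_⟩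
      rintro _ m hm rfl hS
      exact hm ((h m).1 hS)
  rw [hfil] at hsel
  set c := (𝒮.filter (fun S => ∀ m, i m ∈ S ↔ (j m).val < n)).card
  have hnum := numeric_aux n a b (by omega) (by omega)
  rw [hab] at hnum
  have hpos : 0 < Nat.choose (2 * n) n * (n.descFactorial a * n.descFactorial b) := by
    have h1 : 0 < Nat.choose (2 * n) n := Nat.choose_pos (by omega)
    have h2 : 0 < n.descFactorial a := Nat.pos_of_ne_zero (by
      rw [Ne, Nat.descFactorial_eq_zero_iff_lt]; omega)
    have h3 : 0 < n.descFactorial b := Nat.pos_of_ne_zero (by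
      rw [Ne, Nat.descFactorial_eq_zero_iff_lt]; omega)
    positivity
  apply Nat.eq_of_mul_eq_mul_right hpos
  calc N * (2 * n).descFactorial t * (Nat.choose (2 * n) n *
        (n.descFactorial a * n.descFactorial b))
      = (N * (n.descFactorial a * n.descFactorial b)) * Nat.choose (2 * n) n
        * (2 * n).descFactorial t := by ring
    _ = (c * Nat.choose (2 * n) n) * (A₁.card * A₂.card) * (2 * n).descFactorial t := by
        rw [hcount]; ring
    _ = 𝒮.card * A₁.card * A₂.card *
        (Nat.choose (2 * n - t) (n - a) * (2 * n).descFactorial t) := by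
        rw [hsel]; ring
    _ = _ := by rw [hnum]
end

section
/- Let k ≥ 2, n ≥ 1, and t ≥ 0 be integers with 2t+1 ≤ n. Let B be a (2t+1)-wise uniform set of permutations of {1,…,n} and let A_1,…,A_{k−1} be t-wise uniform sets of permutations of {1,…,n}. Let 𝒫 be the set of all ordered partitions P = (P_1,…,P_k) of {1,…,kn} into k pairwise disjoint sets of size n, and for each P and each 1 ≤ i ≤ k fix a bijection f_{P,i} : P_i → {1,…,n}. For P ∈ 𝒫, τ ∈ B, and σ_1 ∈ A_1, …, σ_{k−1} ∈ A_{k−1}, define the permutation μ of {1,…,kn} by μ(x) = τ(f_{P,1}(x)) for x ∈ P_1 and μ(x) = τ(σ_{i−1}(f_{P,i}(x))) + (i−1)·n for x ∈ P_i with 2 ≤ i ≤ k. Then for every injective tuple (i_1,…,i_{2t+1}) of elements of {1,…,kn} and every injective tuple (j_1,…,j_{2t+1}) of elements of {1,…,kn}, the number of tuples (P, τ, σ_1,…,σ_{k−1}) ∈ 𝒫 × B × A_1 × ⋯ × A_{k−1} for which the associated μ satisfies μ(i_a) = j_a for all 1 ≤ a ≤ 2t+1, multiplied by (kn)·(kn−1)⋯(kn−2t),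 equals |𝒫| · |B| · |A_1| ⋯ |A_{k−1}|. That is, the resulting multiset of permutations is (2t+1)-wise uniform. -/
/-- The permutation (given as a function) associated to an ordered partition
`P = (P_0, …, P_{k-1})` of `Fin (kn)` into `k` groups of size `n`, bijections
`f i : P_i ≃ Fin n`, a permutation `τ` and permutations `σ_1, …, σ_{k-1}`:
elements of the first group `P_0` are mapped by `τ ∘ f 0` to the first `n` values, and for
`1 ≤ i ≤ k-1` the elements of `P_i` are mapped by `x ↦ τ(σ_i(f i x)) + i·n`. -/
noncomputable def muFun (n k : ℕ) (P : Fin k → Finset (Fin (k * n)))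
    (f : ∀ i : Fin k, {x // x ∈ P i} ≃ Fin n)
    (τ : Equiv.Perm (Fin n)) (σ : Fin (k - 1) → Equiv.Perm (Fin n))
    (x : Fin (k * n)) : Fin (k * n) :=
  if h : ∃ i, x ∈ P i then
    let i := h.choose
    let w : Fin n :=
      if h0 : (i : ℕ) = 0 then τ (f i ⟨x, h.choose_spec⟩)
      else τ (σ ⟨(i : ℕ) - 1, by have := i.isLt; omega⟩ (f i ⟨x, h.choose_spec⟩))
    ⟨(i : ℕ) * n + (w : ℕ),
      lt_of_lt_of_le (Nat.add_lt_add_left w.isLt _)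
        (by rw [← Nat.succ_mul]; exact Nat.mul_le_mul_right n i.isLt)⟩
  else x

open Finset in
theorem perm_tuple_count {α : Type*} [Fintype α] [DecidableEq α] (t : ℕ) (i j : Fin t → α)
    (hi : Function.Injective i) (hj : Function.Injective j) :
    ((univ : Finset (Equiv.Perm α)).filter (fun σ => ∀ m, σ (i m) = j m)).card
      * Nat.descFactorial (Fintype.card α) t = Nat.factorial (Fintype.card α) := by
  classical
  have hconst : ∀ j' : Fin t ↪ α,
      ((univ : Finset (Equiv.Perm α)).filter (fun σ => ∀ m, σ (i m) = j' m)).card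
      = ((univ : Finset (Equiv.Perm α)).filter (fun σ => ∀ m, σ (i m) = j m)).card := by
    intro j'
    obtain ⟨g, hg⟩ : ∃ g : Equiv.Perm α, ∀ m, g (j' m) = j m := by
      let e : {x // x ∈ Set.range j'} ≃ {x // x ∈ Set.range j} :=
        (Equiv.ofInjective j' j'.injective).symm.trans (Equiv.ofInjective j hj)
      refine ⟨e.extendSubtype, fun m => ?_⟩
      rw [Equiv.extendSubtype_apply_of_mem e (j' m) ⟨m, rfl⟩]
      have : (⟨j' m, ⟨m, rfl⟩⟩ : {x // x ∈ Set.range j'})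
        = Equiv.ofInjective j' j'.injective m := rfl
      rw [this]
      simp only [e, Equiv.trans_apply, Equiv.symm_apply_apply]
      rfl
    refine Finset.card_bij' (fun σ _ => g * σ) (fun σ _ => g⁻¹ * σ) ?_ ?_ ?_ ?_
    · intro σ hσ
      simp only [mem_filter, mem_univ, true_and] at hσ ⊢
      intro m
      rw [Equiv.Perm.mul_apply, hσ, hg]
    · intro σ hσ
      simp only [mem_filter, mem_univ, true_and] at hσ ⊢
      intro m
      rw [Equiv.Perm.mul_apply, hσ, ← hg]
      simp
    · intros; simp
    · intros; simp
  have h1 : (univ : Finset (Equiv.Perm α)).card = ∑ j' : Fin t ↪ α,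
      ((univ : Finset (Equiv.Perm α)).filter (fun σ => ∀ m, σ (i m) = j' m)).card := by
    rw [Finset.card_eq_sum_card_fiberwise
      (f := fun σ : Equiv.Perm α => (⟨fun m => σ (i m), σ.injective.comp hi⟩ : Fin t ↪ α))
      (t := univ) (by intro x _; simp)]
    refine Finset.sum_congr rfl fun j' _ => ?_
    congr 1
    ext σ
    simp [DFunLike.ext_iff]
  rw [Finset.sum_congr rfl (fun j' _ => hconst j'), Finset.sum_const, Finset.card_univ,
    Finset.card_univ, Fintype.card_perm, Fintype.card_embedding_eq, Fintype.card_fin,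
    smul_eq_mul, mul_comm] at h1
  exact h1.symm

open Finset in
theorem univ_uniform_s12 (n t : ℕ) : IsTwiseUniform n t Finset.univ := by
  refine ⟨Finset.univ_nonempty, fun i j hi hj => ?_⟩
  have := perm_tuple_count t i j hi hj
  rw [Finset.card_univ, Fintype.card_perm]
  simpa using this

open Finset in
/-- A condition depending only on the values at `≤ t` points has the same density in a `t`-wise
uniform set as in the full symmetric group. -/
theorem uniform_density {n t : ℕ} (htn : t ≤ n) {T : Finset (Equiv.Perm (Fin n))}
    (hT : IsTwiseUniform n t T) (C : Equiv.Perm (Fin n) → Prop) [DecidablePred C] (X : Finset (Fin n))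
    (hX : X.card ≤ t) (hC : ∀ σ π : Equiv.Perm (Fin n), (∀ x ∈ X, σ x = π x) → C σ → C π) :
    (T.filter C).card * n.factorial = T.card * (univ.filter C).card := by
  obtain ⟨Y, hXY, hY⟩ := Finset.exists_superset_card_eq hX (by simpa using htn)
  let e := Y.equivFinOfCardEq hY
  let i : Fin t → Fin n := fun m => (e.symm m).1
  have hi : Function.Injective i := Subtype.val_injective.comp e.symm.injective
  have hag : ∀ σ π : Equiv.Perm (Fin n), (∀ m, σ (i m) = π (i m)) → ∀ x ∈ X, σ x = π x := by
    intro σ π h x hx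
    have := h (e ⟨x, hXY hx⟩)
    simpa [i] using this
  have key : ∑ π ∈ univ.filter C, (T.filter (fun σ => ∀ m, σ (i m) = π (i m))).card
      = ∑ σ ∈ T.filter C, (univ.filter (fun π : Equiv.Perm (Fin n) =>
          ∀ m, π (i m) = σ (i m))).card := by
    simp only [Finset.card_filter]
    rw [Finset.sum_filter, Finset.sum_filter]
    have e1 : ∀ π : Equiv.Perm (Fin n),
        (if C π then ∑ σ ∈ T, (if ∀ m, σ (i m) = π (i m) then 1 else 0) else 0)
        = ∑ σ ∈ T, (if C π ∧ ∀ m, σ (i m) = π (i m) then 1 else 0) := by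
      intro π; by_cases h : C π <;> simp [h]
    have e2 : ∀ σ : Equiv.Perm (Fin n),
        (if C σ then ∑ π : Equiv.Perm (Fin n), (if ∀ m, π (i m) = σ (i m) then 1 else 0) else 0)
        = ∑ π : Equiv.Perm (Fin n), (if C σ ∧ ∀ m, π (i m) = σ (i m) then 1 else 0) := by
      intro π; by_cases h : C π <;> simp [h]
    rw [Finset.sum_congr rfl (fun π _ => e1 π), Finset.sum_congr rfl (fun π _ => e2 π),
      Finset.sum_comm]
    refine Finset.sum_congr rfl fun σ _ => Finset.sum_congr rfl fun π _ => ?_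
    refine if_congr ⟨fun h => ⟨?_, fun m => (h.2 m).symm⟩, fun h => ⟨?_, fun m => (h.2 m).symm⟩⟩
      rfl rfl
    · exact hC π σ (hag _ _ fun m => (h.2 m).symm) h.1
    · exact hC σ π (hag _ _ fun m => (h.2 m).symm) h.1
  have key2 := congrArg (· * Nat.descFactorial n t) key
  simp only [Finset.sum_mul] at key2
  have e3 : ∀ π : Equiv.Perm (Fin n),
      (T.filter (fun σ => ∀ m, σ (i m) = π (i m))).card * n.descFactorial t = T.card :=
    fun π => hT.2 i (fun m => π (i m)) hi (π.injective.comp hi)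
  have e4 : ∀ σ : Equiv.Perm (Fin n), (univ.filter (fun π : Equiv.Perm (Fin n) =>
      ∀ m, π (i m) = σ (i m))).card * n.descFactorial t = n.factorial := by
    intro σ
    have := perm_tuple_count t i (fun m => σ (i m)) hi (σ.injective.comp hi)
    rwa [Fintype.card_fin] at this
  simp only [e3, e4] at key2
  simp only [Finset.sum_const, smul_eq_mul] at key2
  rw [← key2, mul_comm]

/-- Permutation attached to an optional index. -/
def sOpt {ι : Type*} {n : ℕ} (σ : ι → Equiv.Perm (Fin n)) (o : Option ι) : Equiv.Perm (Fin n) :=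
  o.elim 1 σ

open Finset in
theorem sum_piFinset_split {ι β : Type*} [Fintype ι] [DecidableEq ι] [Inhabited β]
    (A : ι → Finset β) (i : ι) (h : (ι → β) → ℕ) :
    ∑ σ ∈ Fintype.piFinset A, h σ
      = ∑ ρ ∈ Fintype.piFinset (Function.update A i {default}), ∑ g ∈ A i,
          h (Function.update ρ i g) := by
  rw [← Finset.sum_product']
  refine Finset.sum_bij' (fun σ _ => (Function.update σ i default, σ i))
    (fun p _ => Function.update p.1 i p.2) ?_ ?_ ?_ ?_ ?_
  · intro σ hσ
    rw [Fintype.mem_piFinset] at hσ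
    simp only [mem_product, Fintype.mem_piFinset]
    refine ⟨fun j => ?_, hσ i⟩
    by_cases hj : j = i
    · subst hj; simp
    · simpa [hj] using hσ j
  · rintro ⟨ρ, g⟩ hp
    simp only [mem_product, Fintype.mem_piFinset] at hp
    rw [Fintype.mem_piFinset]
    intro j
    by_cases hj : j = i
    · subst hj; simpa using hp.2
    · simpa [hj] using hp.1 j
  · intro σ _; simp
  · rintro ⟨ρ, g⟩ hp
    simp only [mem_product, Fintype.mem_piFinset] at hp
    have := hp.1 i
    simp at this
    simp [← this]
  · intro σ _; simp

open Finset Classical in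
theorem replace_one {ι : Type*} [Fintype ι] [DecidableEq ι] {n t : ℕ} (ht : 2 * t + 1 ≤ n)
    (A : ι → Finset (Equiv.Perm (Fin n))) (i : ι) (hA : IsTwiseUniform n t (A i))
    (c : Fin (2 * t + 1) → Option ι) (y r : Fin (2 * t + 1) → Fin n) :
    (∑ σ ∈ Fintype.piFinset A, (univ.filter (fun τ : Equiv.Perm (Fin n) =>
        ∀ a, τ (sOpt σ (c a) (y a)) = r a)).card) * n.factorial
    = (A i).card * (∑ σ ∈ Fintype.piFinset (Function.update A i univ),
        (univ.filter (fun τ : Equiv.Perm (Fin n) => ∀ a, τ (sOpt σ (c a) (y a)) = r a)).card) := by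
  rw [sum_piFinset_split A i, sum_piFinset_split (Function.update A i univ) i]
  simp only [Function.update_idem, Function.update_self]
  rw [Finset.sum_mul, Finset.mul_sum]
  refine Finset.sum_congr rfl fun ρ _ => ?_
  have hs1 : ∀ g, sOpt (Function.update ρ i g) (some i) = g := by intro g; simp [sOpt]
  have hs2 : ∀ g o, o ≠ some i → sOpt (Function.update ρ i g) o = sOpt ρ o := by
    intro g o ho
    cases o with
    | none => rfl
    | some j =>
      have : j ≠ i := fun h => ho (by rw [h])
      simp [sOpt, this]
  -- generic exchange of summations
  have exch : ∀ (R : Equiv.Perm (Fin n) → Equiv.Perm (Fin n) → Prop)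
      [∀ τ g, Decidable (R τ g)] (T : Finset (Equiv.Perm (Fin n))),
      ∑ g ∈ T, (univ.filter (fun τ => R τ g)).card
        = ∑ τ : Equiv.Perm (Fin n), (T.filter (fun g => R τ g)).card := by
    intro R _ T
    simp only [Finset.card_filter]
    exact Finset.sum_comm
  have main : ∀ (R : Equiv.Perm (Fin n) → Equiv.Perm (Fin n) → Prop)
      [∀ τ g, Decidable (R τ g)],
      (∀ τ, ∃ X : Finset (Fin n), X.card ≤ t ∧ ∀ g g' : Equiv.Perm (Fin n),
        (∀ x ∈ X, g x = g' x) → R τ g → R τ g') →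
      (∑ g ∈ A i, (univ.filter (fun τ => R τ g)).card) * n.factorial
        = (A i).card * ∑ g : Equiv.Perm (Fin n), (univ.filter (fun τ => R τ g)).card := by
    intro R _ hR
    rw [exch, exch, Finset.sum_mul, Finset.mul_sum]
    refine Finset.sum_congr rfl fun τ _ => ?_
    obtain ⟨X, hX, hC⟩ := hR τ
    exact uniform_density (by omega) hA _ X hX hC
  by_cases hsm : (univ.filter (fun a => c a = some i)).card ≤ t
  · refine main (fun τ g => ∀ a, τ (sOpt (Function.update ρ i g) (c a) (y a)) = r a) fun τ => ?_
    refine ⟨(univ.filter (fun a => c a = some i)).image y, Finset.card_image_le.trans hsm, ?_⟩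
    intro g g' hgg hR a
    rw [← hR a]
    by_cases ha : c a = some i
    · rw [ha, hs1, hs1, hgg]
      exact Finset.mem_image_of_mem _ (by simpa using ha)
    · rw [hs2 _ _ ha, hs2 _ _ ha]
  · have hsub : ∀ g : Equiv.Perm (Fin n), (univ.filter (fun τ : Equiv.Perm (Fin n) =>
          ∀ a, τ (sOpt (Function.update ρ i g) (c a) (y a)) = r a)).card
        = (univ.filter (fun τ : Equiv.Perm (Fin n) =>
          ∀ a, (τ * g⁻¹) (sOpt (Function.update ρ i g) (c a) (y a)) = r a)).card := by
      intro g
      refine Finset.card_bij' (fun τ _ => τ * g) (fun τ _ => τ * g⁻¹) ?_ ?_ ?_ ?_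
      · intro τ hτ
        rw [mem_filter] at hτ ⊢
        simpa using hτ.2
      · intro τ hτ
        rw [mem_filter] at hτ ⊢
        simpa using hτ.2
      · intros; simp
      · intros; simp
    simp only [hsub]
    refine main (fun τ g => ∀ a, (τ * g⁻¹) (sOpt (Function.update ρ i g) (c a) (y a)) = r a)
      fun τ => ?_
    refine ⟨(univ.filter (fun a => ¬ c a = some i)).image (fun a => τ⁻¹ (r a)),
      Finset.card_image_le.trans ?_, ?_⟩
    · have := Finset.card_filter_add_card_filter_not (s := (univ : Finset (Fin (2 * t + 1))))
        (fun a => c a = some i)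
      rw [Finset.card_univ, Fintype.card_fin] at this
      omega
    · intro g g' hgg hR a
      have h := hR a
      by_cases ha : c a = some i
      · rw [ha, hs1] at h ⊢
        simpa using h
      · rw [hs2 _ _ ha] at h ⊢
        have hm := hgg (τ⁻¹ (r a)) (Finset.mem_image_of_mem (fun a => τ⁻¹ (r a)) (by simpa using ha))
        rw [← h] at hm ⊢
        simp only [Equiv.Perm.mul_apply] at hm ⊢
        rw [EmbeddingLike.apply_eq_iff_eq, Equiv.Perm.inv_eq_iff_eq]
        simpa using hm

open Finset Classical in
theorem replace_all {ι : Type*} [Fintype ι] [DecidableEq ι] {n t : ℕ} (ht : 2 * t + 1 ≤ n)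
    (B : Finset (Equiv.Perm (Fin n))) (hB : IsTwiseUniform n (2 * t + 1) B)
    (A : ι → Finset (Equiv.Perm (Fin n))) (hA : ∀ i, IsTwiseUniform n t (A i))
    (c : Fin (2 * t + 1) → Option ι) (y r : Fin (2 * t + 1) → Fin n) :
    ((B ×ˢ Fintype.piFinset A).filter (fun q => ∀ a, q.1 (sOpt q.2 (c a) (y a)) = r a)).card
      * (n.factorial * n.factorial ^ Fintype.card ι)
    = (B.card * ∏ i, (A i).card) *
      ((univ : Finset (Equiv.Perm (Fin n) × (ι → Equiv.Perm (Fin n)))).filter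
        (fun q => ∀ a, q.1 (sOpt q.2 (c a) (y a)) = r a)).card := by
  have hcount : ∀ (B : Finset (Equiv.Perm (Fin n))) (A : ι → Finset (Equiv.Perm (Fin n))),
      ((B ×ˢ Fintype.piFinset A).filter (fun q => ∀ a, q.1 (sOpt q.2 (c a) (y a)) = r a)).card
      = ∑ σ ∈ Fintype.piFinset A, (B.filter (fun τ : Equiv.Perm (Fin n) =>
        ∀ a, τ (sOpt σ (c a) (y a)) = r a)).card := by
    intro B A
    simp only [Finset.card_filter]
    rw [Finset.sum_product_right]
  have hu : (univ : Finset (Equiv.Perm (Fin n) × (ι → Equiv.Perm (Fin n))))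
      = univ ×ˢ Fintype.piFinset (fun _ => univ) := by simp
  rw [hu, hcount, hcount]
  set G : (ι → Finset (Equiv.Perm (Fin n))) → ℕ := fun A =>
    ∑ σ ∈ Fintype.piFinset A, (univ.filter (fun τ : Equiv.Perm (Fin n) =>
        ∀ a, τ (sOpt σ (c a) (y a)) = r a)).card with hG
  have h1 : (∑ σ ∈ Fintype.piFinset A, (B.filter (fun τ : Equiv.Perm (Fin n) =>
        ∀ a, τ (sOpt σ (c a) (y a)) = r a)).card) * n.factorial = B.card * G A := by
    rw [hG, Finset.sum_mul, Finset.mul_sum]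
    refine Finset.sum_congr rfl fun σ _ => ?_
    refine uniform_density ht hB _ (univ.image fun a => sOpt σ (c a) (y a))
      (Finset.card_image_le.trans (by simp)) ?_
    intro τ τ' h hR a
    rw [← hR a, h]
    exact Finset.mem_image_of_mem (fun a => sOpt σ (c a) (y a)) (mem_univ a)
  have h2 : ∀ I : Finset ι, G A * n.factorial ^ I.card
      = (∏ i ∈ I, (A i).card) * G (fun i => if i ∈ I then univ else A i) := by
    intro I
    induction I using Finset.induction_on with
    | empty => simp
    | insert i I hi ih =>
      rw [Finset.card_insert_of_notMem hi, pow_succ, ← mul_assoc, ih, Finset.prod_insert hi]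
      have h3 := replace_one ht (fun i => if i ∈ I then univ else A i) i
        (by simpa [hi] using hA i) c y r
      have h4 : Function.update (fun i => if i ∈ I then univ else A i) i univ
          = (fun j => if j ∈ insert i I then univ else A j) := by
        ext1 j
        by_cases hj : j = i
        · subst hj; simp
        · simp [hj]
      rw [h4] at h3
      simp only [hi, if_false] at h3
      change G _ * _ = _ * G _ at h3
      rw [mul_assoc, h3]
      ring
  have h5 := h2 univ
  simp only [mem_univ, if_true, Finset.card_univ] at h5
  rw [← mul_assoc, h1, mul_assoc, h5]
  ring

/-- Index `0` of `Fin k` corresponds to no `σ`, index `i ≥ 1` to `σ_{i-1}`. -/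
def codeIdx {k : ℕ} (i : Fin k) : Option (Fin (k - 1)) :=
  if h : (i : ℕ) = 0 then none else some ⟨(i : ℕ) - 1, by have := i.isLt; omega⟩

theorem muFun_apply (n k : ℕ) (P : Fin k → Finset (Fin (k * n)))
    (hP : ∀ x, ∃! i, x ∈ P i)
    (f : ∀ i : Fin k, {x // x ∈ P i} ≃ Fin n)
    (τ : Equiv.Perm (Fin n)) (σ : Fin (k - 1) → Equiv.Perm (Fin n))
    (x : Fin (k * n)) (i : Fin k) (hx : x ∈ P i) :
    muFun n k P f τ σ x = finProdFinEquiv (i, τ (sOpt σ (codeIdx i) (f i ⟨x, hx⟩))) := by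
  have h : ∃ i, x ∈ P i := ⟨i, hx⟩
  have hc : h.choose = i := (hP x).unique h.choose_spec hx
  unfold muFun
  rw [dif_pos h]
  have aux : ∀ (j : Fin k) (hj : x ∈ P j) (_ : j = i) (hj1 : ¬ (j : ℕ) = 0 → (j : ℕ) - 1 < k - 1) (hlt),
      (⟨(j : ℕ) * n + ((if h0 : (j : ℕ) = 0 then τ (f j ⟨x, hj⟩)
      else τ (σ ⟨(j : ℕ) - 1, hj1 h0⟩ (f j ⟨x, hj⟩)) : Fin n) : ℕ), hlt⟩
        : Fin (k * n))
      = finProdFinEquiv (i, τ (sOpt σ (codeIdx i) (f i ⟨x, hx⟩))) := by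
    intro j hj hji hj1 hlt
    subst hji
    apply Fin.ext
    simp only [finProdFinEquiv_apply_val, codeIdx, sOpt]
    split_ifs with h0
    · simp [add_comm, mul_comm]
    · simp [add_comm, mul_comm]
  exact aux _ h.choose_spec hc (fun h0 => by have := h.choose.isLt; omega) _

open Finset Classical in
theorem exists_mu_equiv (k n : ℕ) (hk : 2 ≤ k)
    (𝒮 : Finset (Fin k → Finset (Fin (k * n))))
    (h𝒮 : ∀ P, P ∈ 𝒮 ↔ ((∀ i, (P i).card = n) ∧ ∀ x, ∃! i, x ∈ P i))
    (f : (P : Fin k → Finset (Fin (k * n))) → P ∈ 𝒮 → ∀ i : Fin k, {x // x ∈ P i} ≃ Fin n) :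
    ∃ E : ({P // P ∈ 𝒮} × Equiv.Perm (Fin n) × (Fin (k - 1) → Equiv.Perm (Fin n)))
        ≃ Equiv.Perm (Fin (k * n)),
      ∀ q x, E q x = muFun n k q.1.1 (f q.1.1 q.1.2) q.2.1 q.2.2 x := by
  have hmu : ∀ (q : {P // P ∈ 𝒮} × Equiv.Perm (Fin n) × (Fin (k - 1) → Equiv.Perm (Fin n)))
      (x : Fin (k * n)) (i : Fin k) (hx : x ∈ q.1.1 i),
      muFun n k q.1.1 (f q.1.1 q.1.2) q.2.1 q.2.2 x
        = finProdFinEquiv (i, q.2.1 (sOpt q.2.2 (codeIdx i) (f q.1.1 q.1.2 i ⟨x, hx⟩))) :=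
    fun q x i hx => muFun_apply n k q.1.1 ((h𝒮 _).1 q.1.2).2 _ _ _ x i hx
  have hinj : ∀ q : {P // P ∈ 𝒮} × Equiv.Perm (Fin n) × (Fin (k - 1) → Equiv.Perm (Fin n)),
      Function.Injective (muFun n k q.1.1 (f q.1.1 q.1.2) q.2.1 q.2.2) := by
    intro q x x' hxx
    obtain ⟨i, hx, -⟩ := ((h𝒮 _).1 q.1.2).2 x
    obtain ⟨i', hx', -⟩ := ((h𝒮 _).1 q.1.2).2 x'
    rw [hmu q x i hx, hmu q x' i' hx', EmbeddingLike.apply_eq_iff_eq, Prod.mk.injEq] at hxx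
    obtain ⟨rfl, h2⟩ := hxx
    simpa using h2
  let F : ({P // P ∈ 𝒮} × Equiv.Perm (Fin n) × (Fin (k - 1) → Equiv.Perm (Fin n)))
      → Equiv.Perm (Fin (k * n)) := fun q =>
    Equiv.ofBijective _ (Finite.injective_iff_bijective.1 (hinj q))
  have hF : ∀ q x, F q x = muFun n k q.1.1 (f q.1.1 q.1.2) q.2.1 q.2.2 x := fun q x => rfl
  refine ⟨Equiv.ofBijective F ⟨?_, ?_⟩, fun q x => hF q x⟩
  · rintro ⟨⟨P, hP⟩, τ, σ⟩ ⟨⟨P', hP'⟩, τ', σ'⟩ h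
    have hx : ∀ x, muFun n k P (f P hP) τ σ x = muFun n k P' (f P' hP') τ' σ' x := by
      intro x
      have := congrArg (fun e : Equiv.Perm (Fin (k * n)) => e x) h
      simpa only [hF] using this
    have hPP : P = P' := by
      funext i
      ext x
      obtain ⟨j, hj, huj⟩ := ((h𝒮 _).1 hP).2 x
      obtain ⟨j', hj', huj'⟩ := ((h𝒮 _).1 hP').2 x
      have h1 := hx x
      rw [hmu ⟨⟨P, hP⟩, τ, σ⟩ x j hj, hmu ⟨⟨P', hP'⟩, τ', σ'⟩ x j' hj',
        EmbeddingLike.apply_eq_iff_eq, Prod.mk.injEq] at h1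
      obtain ⟨rfl, -⟩ := h1
      constructor
      · intro hi; rw [huj i hi]; exact hj'
      · intro hi; rw [huj' i hi]; exact hj
    subst hPP
    have hg : ∀ (i : Fin k) (z : Fin n),
        τ (sOpt σ (codeIdx i) z) = τ' (sOpt σ' (codeIdx i) z) := by
      intro i z
      have hm := ((f P hP i).symm z).2
      have h1 := hx ((f P hP i).symm z).1
      rw [hmu ⟨⟨P, hP⟩, τ, σ⟩ _ i hm, hmu ⟨⟨P, hP'⟩, τ', σ'⟩ _ i hm,
        EmbeddingLike.apply_eq_iff_eq, Prod.mk.injEq] at h1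
      simpa using h1.2
    have hτ : τ = τ' := by
      ext1 z
      have := hg ⟨0, by omega⟩ z
      simpa [codeIdx, sOpt] using this
    subst hτ
    have hσ : σ = σ' := by
      funext j
      ext1 z
      have := hg ⟨j + 1, by omega⟩ z
      simpa [codeIdx, sOpt] using this
    subst hσ
    rfl
  · intro μ
    let P : Fin k → Finset (Fin (k * n)) := fun i =>
      univ.filter (fun x => (finProdFinEquiv.symm (μ x)).1 = i)
    have hmem : ∀ i x, x ∈ P i ↔ (finProdFinEquiv.symm (μ x)).1 = i := by
      intro i x; simp [P]
    have hP : P ∈ 𝒮 := by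
      rw [h𝒮]
      refine ⟨fun i => ?_, fun x => ⟨_, (hmem _ x).2 rfl, fun j hj => ((hmem _ x).1 hj).symm⟩⟩
      have hinj1 : Function.Injective (fun w : Fin n => μ.symm (finProdFinEquiv (i, w))) := by
        intro w w' hw
        simpa using hw
      have : P i = (univ : Finset (Fin n)).image
          (fun w => μ.symm (finProdFinEquiv (i, w))) := by
        ext x
        rw [hmem]
        simp only [mem_image, mem_univ, true_and]
        constructor
        · intro h
          refine ⟨(finProdFinEquiv.symm (μ x)).2, ?_⟩
          rw [← h, Prod.mk.eta, Equiv.apply_symm_apply, Equiv.symm_apply_apply]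
        · rintro ⟨w, rfl⟩
          rw [Equiv.apply_symm_apply, Equiv.symm_apply_apply]
      rw [this, card_image_of_injective _ hinj1, card_univ, Fintype.card_fin]
    have gb : ∀ i : Fin k, Function.Injective (fun z : Fin n =>
        (finProdFinEquiv.symm (μ ((f P hP i).symm z).1)).2) := by
      intro i z z' h
      have h1 := (hmem i _).1 ((f P hP i).symm z).2
      have h2 := (hmem i _).1 ((f P hP i).symm z').2
      have h3 := Prod.ext (h1.trans h2.symm) h
      exact (f P hP i).symm.injective (Subtype.val_injective
        (μ.injective (finProdFinEquiv.symm.injective h3)))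
    let g : Fin k → Equiv.Perm (Fin n) := fun i =>
      Equiv.ofBijective _ (Finite.injective_iff_bijective.1 (gb i))
    have hgv : ∀ i z, g i z = (finProdFinEquiv.symm (μ ((f P hP i).symm z).1)).2 :=
      fun i z => rfl
    let τ := g ⟨0, by omega⟩
    let σ : Fin (k - 1) → Equiv.Perm (Fin n) := fun j => τ⁻¹ * g ⟨j + 1, by omega⟩
    have hs : ∀ i z, τ (sOpt σ (codeIdx i) z) = g i z := by
      intro i z
      by_cases h0 : (i : ℕ) = 0
      · have : i = (⟨0, by omega⟩ : Fin k) := Fin.ext h0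
        rw [this]
        simp [codeIdx, sOpt, τ]
      · have : (⟨(i : ℕ) - 1 + 1, by omega⟩ : Fin k) = i := Fin.ext (by simp; omega)
        simp [codeIdx, sOpt, σ, h0, this]
    refine ⟨⟨⟨P, hP⟩, τ, σ⟩, ?_⟩
    ext1 x
    rw [hF, hmu ⟨⟨P, hP⟩, τ, σ⟩ x _ ((hmem _ x).2 rfl), hs, hgv,
      Equiv.symm_apply_apply, Prod.mk.eta, Equiv.apply_symm_apply]

open Classical in
/-- Generalized construction: with `𝒮` the set of all ordered partitions of `Fin (kn)` into
`k` groups of size `n`, `B` a `(2t+1)`-wise uniform set, and `A_1, …, A_{k-1}` `t`-wise uniform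
sets of permutations on `n` elements, the multiset of permutations `μ` built by `muFun` is
`(2t+1)`-wise uniform: for all injective tuples `idx`, `jdx` of `2t+1` elements of `Fin (kn)`,
the number of tuples `(P, τ, σ)` whose `μ` maps `idx a` to `jdx a` for all `a`, times
`(kn)(kn−1)⋯(kn−2t)`, equals `|𝒮|·|B|·∏ i, |A_i|`. -/
theorem generalized_construction (k n t : ℕ) (hk : 2 ≤ k) (hn : 1 ≤ n) (ht : 2 * t + 1 ≤ n)
    (B : Finset (Equiv.Perm (Fin n))) (hB : IsTwiseUniform n (2 * t + 1) B)
    (A : Fin (k - 1) → Finset (Equiv.Perm (Fin n))) (hA : ∀ i, IsTwiseUniform n t (A i))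
    (𝒮 : Finset (Fin k → Finset (Fin (k * n))))
    (h𝒮 : ∀ P, P ∈ 𝒮 ↔ ((∀ i, (P i).card = n) ∧ ∀ x, ∃! i, x ∈ P i))
    (f : (P : Fin k → Finset (Fin (k * n))) → P ∈ 𝒮 → ∀ i : Fin k, {x // x ∈ P i} ≃ Fin n)
    (idx jdx : Fin (2 * t + 1) → Fin (k * n))
    (hi : Function.Injective idx) (hj : Function.Injective jdx) :
    ((𝒮.attach ×ˢ B ×ˢ Fintype.piFinset A).filter
        (fun q => ∀ a, muFun n k q.1.1 (f q.1.1 q.1.2) q.2.1 q.2.2 (idx a) = jdx a)).card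
        * Nat.descFactorial (k * n) (2 * t + 1)
      = 𝒮.card * B.card * ∏ i, (A i).card := by
  obtain ⟨E, hE⟩ := exists_mu_equiv k n hk 𝒮 h𝒮 f
  have hcard : 𝒮.card * (n.factorial * n.factorial ^ (k - 1)) = (k * n).factorial := by
    have := Fintype.card_congr E
    simpa [Fintype.card_perm] using this
  have hfull : ((𝒮.attach ×ˢ (Finset.univ : Finset (Equiv.Perm (Fin n) ×
        (Fin (k - 1) → Equiv.Perm (Fin n))))).filter
        (fun q => ∀ a, muFun n k q.1.1 (f q.1.1 q.1.2) q.2.1 q.2.2 (idx a) = jdx a)).card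
        * Nat.descFactorial (k * n) (2 * t + 1) = (k * n).factorial := by
    have h := perm_tuple_count (2 * t + 1) idx jdx hi hj
    rw [Fintype.card_fin] at h
    rw [← h]
    congr 1
    refine Finset.card_bij' (fun q _ => E q) (fun μ _ => E.symm μ) ?_ ?_ ?_ ?_
    · intro q hq
      rw [Finset.mem_filter] at hq ⊢
      refine ⟨Finset.mem_univ _, fun a => ?_⟩
      rw [hE]
      exact hq.2 a
    · intro μ hμ
      rw [Finset.mem_filter] at hμ ⊢
      refine ⟨by simp, fun a => ?_⟩
      rw [← hE, Equiv.apply_symm_apply]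
      exact hμ.2 a
    · intros; simp
    · intros; simp
  have hrep : ((𝒮.attach ×ˢ B ×ˢ Fintype.piFinset A).filter
        (fun q => ∀ a, muFun n k q.1.1 (f q.1.1 q.1.2) q.2.1 q.2.2 (idx a) = jdx a)).card
        * (n.factorial * n.factorial ^ (k - 1))
      = (B.card * ∏ i, (A i).card) *
        ((𝒮.attach ×ˢ (Finset.univ : Finset (Equiv.Perm (Fin n) ×
        (Fin (k - 1) → Equiv.Perm (Fin n))))).filter
        (fun q => ∀ a, muFun n k q.1.1 (f q.1.1 q.1.2) q.2.1 q.2.2 (idx a) = jdx a)).card := by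
    simp only [Finset.card_filter]
    rw [Finset.sum_product, Finset.sum_product, Finset.sum_mul, Finset.mul_sum]
    refine Finset.sum_congr rfl fun P _ => ?_
    simp only [← Finset.card_filter]
    obtain ⟨P, hP⟩ := P
    have hP2 := ((h𝒮 _).1 hP).2
    by_cases hcomp : ∀ a, idx a ∈ P (finProdFinEquiv.symm (jdx a)).1
    · have h := replace_all ht B hB A hA
        (fun a => codeIdx (finProdFinEquiv.symm (jdx a)).1)
        (fun a => f P hP _ ⟨idx a, hcomp a⟩) (fun a => (finProdFinEquiv.symm (jdx a)).2)
      rw [Fintype.card_fin] at h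
      have hiff : ∀ (τ : Equiv.Perm (Fin n)) (σ : Fin (k - 1) → Equiv.Perm (Fin n)),
          (∀ a, muFun n k P (f P hP) τ σ (idx a) = jdx a) ↔
          ∀ a, τ (sOpt σ (codeIdx (finProdFinEquiv.symm (jdx a)).1)
            (f P hP _ ⟨idx a, hcomp a⟩)) = (finProdFinEquiv.symm (jdx a)).2 := by
        intro τ σ
        refine forall_congr' fun a => ?_
        rw [muFun_apply n k P hP2 (f P hP) τ σ (idx a) _ (hcomp a), ← Equiv.eq_symm_apply,
          Prod.ext_iff]
        simp
      simp only [hiff]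
      convert h using 3 <;> (ext q; simp only [Finset.mem_filter])
    · have hno : ∀ (τ : Equiv.Perm (Fin n)) (σ : Fin (k - 1) → Equiv.Perm (Fin n)),
          ¬ (∀ a, muFun n k P (f P hP) τ σ (idx a) = jdx a) := by
        intro τ σ h
        apply hcomp
        intro a
        obtain ⟨i, hx, -⟩ := hP2 (idx a)
        have h1 := h a
        rw [muFun_apply n k P hP2 (f P hP) τ σ (idx a) i hx] at h1
        rw [← h1, Equiv.symm_apply_apply]
        exact hx
      simp [hno]
  have hpos : 0 < n.factorial * n.factorial ^ (k - 1) := by positivity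
  apply Nat.eq_of_mul_eq_mul_right hpos
  rw [mul_right_comm, hrep, mul_assoc, hfull, ← hcard]
  ring
end
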